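/- arXiv:2004.03908 — 3 statements merged into one kernel-verified Lean document; each statement's English description precedes it below -/
import Mathlib

section
/- Let d ≥ 1, k ≥ 2 and d/2 − d/k < s < d/2. There exists C = C(d,k,s) such that for all g₁, …, g_k : ℝ^d → [0,∞] measurable with ∫ |ξ|^{2s} g_ℓ(ξ)² dξ < ∞ for each ℓ, there is a function f ∈ L²(ℝ^d) with ‖f‖_{L²} ≤ 1 such that for almost every ξ: (g₁ ⋆ g₂ ⋆ ⋯ ⋆ g_k)(ξ) ≤ C |ξ|^{−(ks − (k−1)d/2)} f(ξ) ∏_{ℓ=1}^k ( ∫ |η|^{2s} g_ℓ(η)² dη )^{1/2}. -/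
open MeasureTheory Real Filter Topology
open scoped ENNReal NNReal

noncomputable section

/-- Euclidean space `ℝ^d`. -/
abbrev Rd (d : ℕ) := EuclideanSpace ℝ (Fin d)

/-- `ℂ^N` with the Euclidean norm. -/
abbrev CN (N : ℕ) := EuclideanSpace ℂ (Fin N)

/-- The homogeneous Sobolev norm `‖f‖_{Ḣ^s(ℝ^d)}` of a (vector-valued) function whose
Fourier transform is `g`:  `(∫ |ξ|^{2s} |g(ξ)|² dξ)^{1/2}`, valued in `ℝ≥0∞`. -/
def hSob (d N : ℕ) (s : ℝ) (g : Rd d → CN N) : ℝ≥0∞ :=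
  (∫⁻ ξ : Rd d, ENNReal.ofReal (‖ξ‖ ^ (2 * s) * ‖g ξ‖ ^ 2)) ^ (1/2 : ℝ)

/-- The same homogeneous Sobolev norm for a scalar nonnegative Fourier-side function. -/
def hSobR (d : ℕ) (s : ℝ) (g : Rd d → ℝ) : ℝ≥0∞ :=
  (∫⁻ ξ : Rd d, ENNReal.ofReal (‖ξ‖ ^ (2 * s) * g ξ ^ 2)) ^ (1/2 : ℝ)

/-- The same homogeneous Sobolev norm for a scalar complex Fourier-side function. -/
def hSobC (d : ℕ) (s : ℝ) (g : Rd d → ℂ) : ℝ≥0∞ :=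
  (∫⁻ ξ : Rd d, ENNReal.ofReal (‖ξ‖ ^ (2 * s) * ‖g ξ‖ ^ 2)) ^ (1/2 : ℝ)

/-- The Kato norm `‖U‖_{K^p_T} = sup_{0<t≤T} t^{1/p} ‖U(t)‖_{Ḣ^{s+2/p}}`,
for `U` given by its Fourier transform. -/
def kato (d N : ℕ) (s p T : ℝ) (U : ℝ → Rd d → CN N) : ℝ≥0∞ :=
  ⨆ t ∈ Set.Ioc (0:ℝ) T, ENNReal.ofReal (t ^ (1/p)) * hSob d N (s + 2/p) (U t)

/-- The Kato norm for a scalar nonnegative Fourier-side function of time. -/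
def katoR (d : ℕ) (s p T : ℝ) (g : ℝ → Rd d → ℝ) : ℝ≥0∞ :=
  ⨆ t ∈ Set.Ioc (0:ℝ) T, ENNReal.ofReal (t ^ (1/p)) * hSobR d (s + 2/p) (g t)

/-- Fourier multiplier of the heat flow `e^{aΔ}` applied to (the Fourier transform) `g`. -/
def heatHat (d N : ℕ) (a : ℝ) (g : Rd d → CN N) : Rd d → CN N :=
  fun ξ => Real.exp (-(a * ‖ξ‖ ^ 2)) • g ξ

/-- The Kato norm `sup_{0<τ≤T} τ^{1/p} ‖e^{ντΔ}U₀‖_{Ḣ^{s+2/p}}` of the heat flow. -/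
def heatKato (d N : ℕ) (ν s p T : ℝ) (g : Rd d → CN N) : ℝ≥0∞ :=
  ⨆ τ ∈ Set.Ioc (0:ℝ) T, ENNReal.ofReal (τ ^ (1/p)) * hSob d N (s + 2/p) (heatHat d N (ν * τ) g)

/-- The Gevrey-weighted modulus of the Fourier transform of `U`:
`Û_a(t,ξ) = e^{-λ²t/(4(1-ε)T) + λt|ξ|/√T} |Û(t,ξ)|`. -/
def gevreyHat (d N : ℕ) (ε lam T : ℝ) (U : ℝ → Rd d → CN N) : ℝ → Rd d → ℝ :=
  fun t ξ =>
    Real.exp (-(lam ^ 2 * t) / (4 * (1 - ε) * T) + lam * t * ‖ξ‖ / Real.sqrt T) * ‖U t ξ‖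

/-- `convIter d g n` is the `(n+1)`-fold convolution `g ⋆ ⋯ ⋆ g` of a nonnegative function. -/
def convIter (d : ℕ) (g : Rd d → ℝ≥0∞) : ℕ → Rd d → ℝ≥0∞
  | 0 => g
  | n + 1 => fun ξ => ∫⁻ η : Rd d, g η * convIter d g n (ξ - η)

/-- The Fourier-side Duhamel inequality: for all `t ∈ (0,T]` and `ξ`,
`|Û(t,ξ)| ≤ e^{-t|ξ|²}|Û₀(ξ)| + C₀ ∫₀ᵗ e^{-(t-t')|ξ|²} |ξ|^β (|Û(t')|⋆⋯⋆|Û(t')|)(ξ) dt'`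
(with a `k`-fold convolution). -/
def DuhamelIneq (d N k : ℕ) (β C₀ T : ℝ) (U₀ : Rd d → CN N) (U : ℝ → Rd d → CN N) : Prop :=
  ∀ t ∈ Set.Ioc (0:ℝ) T, ∀ ξ : Rd d,
    ENNReal.ofReal ‖U t ξ‖ ≤
      ENNReal.ofReal (Real.exp (-(t * ‖ξ‖ ^ 2)) * ‖U₀ ξ‖) +
        ENNReal.ofReal C₀ *
          ∫⁻ t' in Set.Ioc (0:ℝ) t,
            ENNReal.ofReal (Real.exp (-((t - t') * ‖ξ‖ ^ 2)) * ‖ξ‖ ^ β) *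
              convIter d (fun η => ENNReal.ofReal ‖U t' η‖) (k - 1) ξ

/-- Lower bound `R` for the radius of spatial analyticity of a function whose Fourier
transform is `g`: `R = sup{ρ ≥ 0 : ∫ e^{2ρ|ξ|} |ξ|^{2s} |g(ξ)|² dξ < ∞}`. -/
def anaRadius (d N : ℕ) (s : ℝ) (g : Rd d → CN N) : ℝ≥0∞ :=
  ⨆ ρ ∈ {ρ : ℝ | 0 ≤ ρ ∧
      (∫⁻ ξ : Rd d, ENNReal.ofReal (Real.exp (2 * ρ * ‖ξ‖) * ‖ξ‖ ^ (2 * s) * ‖g ξ‖ ^ 2)) < ⊤},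
    ENNReal.ofReal ρ

/-- The convolution of `n+1` complex-valued functions on `ℝ^d`. -/
def multiConvC (d n : ℕ) (g : Fin (n + 1) → Rd d → ℂ) (ξ : Rd d) : ℂ :=
  ∫ η : Fin n → Rd d, (∏ i : Fin n, g i.castSucc (η i)) * g (Fin.last n) (ξ - ∑ i, η i)

/-- A symbol which is continuous away from `0` and homogeneous of degree `β`. -/
def SymbolHomog (d : ℕ) (β : ℝ) (a : Rd d → ℂ) : Prop :=
  ContinuousOn a {ξ : Rd d | ξ ≠ 0} ∧
    ∀ μ : ℝ, 0 < μ → ∀ ξ : Rd d, ξ ≠ 0 → a (μ • ξ) = ((μ ^ β : ℝ) : ℂ) * a ξ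

/-- Fourier-side formulation of a mild solution of (SP) on `(0,T]`, with nonlinearity of
order `k = K+1` given by symbols `a j m` (indexed by the choice `m` of the component of `U`
appearing in each of the `k` factors, an equivalent parametrization of the multi-indices
`ℓ ∈ ℕ^N`, `|ℓ| = k`):
`Û_j(t,ξ) = e^{-t|ξ|²} Û₀_j(ξ) + ∫₀ᵗ e^{-(t-t')|ξ|²} Σ_m a_{j,m}(ξ) (2π)^{-dK} (Û_{m 0} ⋆ ⋯ ⋆ Û_{m K})(ξ) dt'`. -/
def IsMildSolSP (d N K : ℕ) (T : ℝ) (a : Fin N → (Fin (K + 1) → Fin N) → Rd d → ℂ)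
    (U₀ : Rd d → CN N) (U : ℝ → Rd d → CN N) : Prop :=
  ∀ t ∈ Set.Ioc (0:ℝ) T, ∀ ξ : Rd d, ∀ j : Fin N,
    U t ξ j = (Real.exp (-(t * ‖ξ‖ ^ 2)) : ℂ) * U₀ ξ j +
      (((2 * Real.pi) ^ (d * K) : ℝ) : ℂ)⁻¹ *
        ∫ t' in Set.Ioc (0:ℝ) t,
          (Real.exp (-((t - t') * ‖ξ‖ ^ 2)) : ℂ) *
            ∑ m : Fin (K + 1) → Fin N, a j m ξ * multiConvC d K (fun i η => U t' η (m i)) ξ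


/-- The convolution of `n+1` nonnegative (extended-real-valued) functions on `ℝ^d`. -/
def multiConvE (d n : ℕ) (g : Fin (n + 1) → Rd d → ℝ≥0∞) (ξ : Rd d) : ℝ≥0∞ :=
  ∫⁻ η : Fin n → Rd d, (∏ i : Fin n, g i.castSucc (η i)) * g (Fin.last n) (ξ - ∑ i, η i)


lemma measurable_insertNth' {E : Type} [MeasurableSpace E] {n : ℕ} (i : Fin (n+1)) :
    Measurable (fun p : E × (Fin n → E) => (i.insertNth p.1 p.2 : Fin (n+1) → E)) :=
  (MeasurableEquiv.piFinSuccAbove (fun _ => E) i).symm.measurable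

lemma measurable_insertNth_comp {E X : Type} [MeasurableSpace E] [MeasurableSpace X] {n : ℕ}
    (i : Fin (n+1)) {a : X → E} {b : X → Fin n → E} (ha : Measurable a) (hb : Measurable b) :
    Measurable (fun x => (i.insertNth (a x) (b x) : Fin (n+1) → E)) :=
  (measurable_insertNth' i).comp (ha.prodMk hb)

lemma lsplit {d n : ℕ} (i : Fin (n+1)) (Ψ : (Fin (n+1) → Rd d) → ℝ≥0∞) (hΨ : Measurable Ψ) :
    ∫⁻ v, Ψ v = ∫⁻ a : Rd d, ∫⁻ y : Fin n → Rd d, Ψ (i.insertNth a y) := by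
  have h := (volume_preserving_piFinSuccAbove (fun _ : Fin (n+1) => Rd d) i).symm
  rw [← h.lintegral_comp hΨ]
  exact lintegral_prod _ (hΨ.comp h.measurable).aemeasurable

lemma lsplit' {d n : ℕ} (i : Fin (n+1)) (Ψ : (Fin (n+1) → Rd d) → ℝ≥0∞) (hΨ : Measurable Ψ) :
    ∫⁻ v, Ψ v = ∫⁻ y : Fin n → Rd d, ∫⁻ a : Rd d, Ψ (i.insertNth a y) := by
  rw [lsplit i Ψ hΨ, lintegral_lintegral_swap]
  exact (hΨ.comp (measurable_insertNth' i)).aemeasurable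

lemma lprod {d : ℕ} : ∀ {n : ℕ} (F : Fin n → Rd d → ℝ≥0∞) (_ : ∀ i, Measurable (F i)),
    ∫⁻ v : Fin n → Rd d, ∏ i, F i (v i) = ∏ i, ∫⁻ a, F i a := by
  intro n
  induction n with
  | zero =>
    intro F hF
    simp [MeasureTheory.volume_pi]
  | succ n ih =>
    intro F hF
    rw [lsplit 0]
    · simp only [Fin.prod_univ_succ]
      simp only [Fin.insertNth_zero', Fin.cons_zero, Fin.cons_succ]
      have : ∀ a, ∫⁻ y : Fin n → Rd d, F 0 a * ∏ i, F i.succ (y i)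
          = F 0 a * ∏ i : Fin n, ∫⁻ a, F i.succ a := by
        intro a
        rw [lintegral_const_mul, ih (fun i => F i.succ) (fun i => hF _)]
        exact Finset.measurable_prod _ (fun i _ => (hF _).comp (measurable_pi_apply i))
      simp_rw [this]
      rw [lintegral_mul_const _ (hF 0)]
    · exact Finset.measurable_prod _ (fun i _ => (hF _).comp (measurable_pi_apply i))

/-- parametrization of the hyperplane `∑ x = 0`, solving for coordinate `i`. -/
def hpar {d n : ℕ} (i : Fin (n+1)) (v : Fin n → Rd d) : Fin (n+1) → Rd d :=
  i.insertNth (-∑ l, v l) v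

lemma measurable_hpar {d n : ℕ} (i : Fin (n+1)) : Measurable (hpar (d := d) i) := by
  apply measurable_insertNth_comp i _ measurable_id
  fun_prop

lemma hpar_zero_eq {d n : ℕ} (i : Fin (n+2)) (Φ : (Fin (n+2) → Rd d) → ℝ≥0∞) (hΦ : Measurable Φ) :
    ∫⁻ v, Φ (hpar 0 v) = ∫⁻ v, Φ (hpar i v) := by
  refine Fin.cases rfl (fun j => ?_) i
  rw [lsplit' j (fun v => Φ (hpar 0 v)) (hΦ.comp (measurable_hpar 0)),
    lsplit' 0 (fun v => Φ (hpar j.succ v)) (hΦ.comp (measurable_hpar j.succ))]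
  refine lintegral_congr fun y => ?_
  rw [← lintegral_sub_left_eq_self _ (-∑ l, y l)]
  refine lintegral_congr fun a => ?_
  congr 1
  simp only [hpar, Fin.insertNth_zero']
  rw [Fin.insertNth_succ_cons]
  rw [Fin.sum_univ_succAbove _ j, Fin.sum_univ_succ]
  simp only [Fin.insertNth_apply_same, Fin.insertNth_apply_succAbove, Fin.cons_zero, Fin.cons_succ]
  congr 1
  · abel
  · congr 1; abel

lemma hpar_sum {d n : ℕ} (i : Fin (n+1)) (v : Fin n → Rd d) : ∑ l, hpar i v l = 0 := by
  rw [Fin.sum_univ_succAbove _ i]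
  simp [hpar]

lemma form_eq {d m : ℕ} (g : Fin (m + 1) → Rd d → ℝ≥0∞) (hg : ∀ l, Measurable (g l))
    (f : Rd d → ℝ≥0∞) (hf : Measurable f) :
    ∫⁻ ξ, f ξ * multiConvE d m g ξ =
      ∫⁻ v : Fin (m+1) → Rd d, ∏ l, (Fin.cons (fun x => f (-x)) g : Fin (m+2) → Rd d → ℝ≥0∞) l (hpar 0 v l) := by
  have hm : Measurable (fun p : Rd d × (Fin m → Rd d) => (∏ i : Fin m, g i.castSucc (p.2 i)) * g (Fin.last m) (p.1 - ∑ i, p.2 i)) := by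
    apply Measurable.mul
    · exact Finset.measurable_prod _ (fun i _ => (hg _).comp (by fun_prop))
    · exact (hg _).comp (by fun_prop)
  have e1 : ∀ ξ, f ξ * multiConvE d m g ξ = ∫⁻ η : Fin m → Rd d, f ξ * ((∏ i : Fin m, g i.castSucc (η i)) * g (Fin.last m) (ξ - ∑ i, η i)) := by
    intro ξ
    rw [lintegral_const_mul]
    · rfl
    · exact hm.comp measurable_prodMk_left
  simp_rw [e1]
  rw [lintegral_lintegral_swap, lsplit' (Fin.last m)]
  · refine lintegral_congr fun η => ?_
    rw [← lintegral_sub_right_eq_self _ (-∑ i, η i)]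
    refine lintegral_congr fun a => ?_
    simp only [hpar, Fin.insertNth_zero', Fin.prod_univ_succ (n := m+1), Fin.cons_zero, Fin.cons_succ, Fin.insertNth_last']
    rw [Fin.prod_univ_castSucc, Fin.sum_univ_castSucc]
    simp only [Fin.snoc_castSucc, Fin.snoc_last, neg_neg, sub_neg_eq_add, add_sub_cancel_right]
    rw [add_comm a]
  · refine Finset.measurable_prod _ (fun i _ => ?_)
    refine Measurable.comp ?_ ((measurable_pi_apply i).comp (measurable_hpar 0))
    refine Fin.cases ?_ (fun j => ?_) i
    · exact hf.comp measurable_neg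
    · exact hg j
  · exact ((hf.comp measurable_fst).mul hm).aemeasurable

/-- power weight -/
def pw {d : ℕ} (r : ℝ) (x : Rd d) : ℝ≥0∞ := ENNReal.ofReal (‖x‖ ^ r)

lemma measurable_pw {d : ℕ} (r : ℝ) : Measurable (pw (d := d) r) := by
  unfold pw; fun_prop

lemma pw_mul {d : ℕ} (r r' : ℝ) {x : Rd d} (hx : x ≠ 0) : pw r x * pw r' x = pw (r + r') x := by
  unfold pw
  rw [← ENNReal.ofReal_mul (by positivity), ← Real.rpow_add (norm_pos_iff.2 hx)]

lemma pw_sq {d : ℕ} (r : ℝ) (x : Rd d) : pw r x ^ 2 = pw (2 * r) x := by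
  unfold pw
  rw [← ENNReal.ofReal_pow (by positivity), mul_comm 2 r, Real.rpow_mul (norm_nonneg x)]
  norm_num

lemma pw_zero {d : ℕ} (x : Rd d) : pw 0 x = 1 := by simp [pw]

lemma pw_prod {d : ℕ} {ι : Type*} (S : Finset ι) (r : ι → ℝ) {x : Rd d} (hx : x ≠ 0) :
    ∏ l ∈ S, pw (r l) x = pw (∑ l ∈ S, r l) x := by
  classical
  induction S using Finset.induction_on with
  | empty => simp [pw_zero]
  | insert a S ha ih => rw [Finset.prod_insert ha, Finset.sum_insert ha, ih, pw_mul _ _ hx]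

lemma pw_ne_top {d : ℕ} (r : ℝ) (x : Rd d) : pw r x ≠ ⊤ := ENNReal.ofReal_ne_top

lemma pw_comparable {d : ℕ} (r M : ℝ) (hM : 1 ≤ M) {x y : Rd d} (hx : x ≠ 0) (hy : y ≠ 0)
    (h1 : ‖x‖ ≤ ‖y‖) (h2 : ‖y‖ ≤ M * ‖x‖) :
    pw r x ≤ ENNReal.ofReal (M ^ |r|) * pw r y := by
  unfold pw
  have hx' := norm_pos_iff.2 hx
  have hy' := norm_pos_iff.2 hy
  rw [← ENNReal.ofReal_mul (by positivity)]
  apply ENNReal.ofReal_le_ofReal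
  rcases le_total 0 r with hr | hr
  · calc ‖x‖ ^ r ≤ ‖y‖ ^ r := Real.rpow_le_rpow hx'.le h1 hr
      _ ≤ M ^ |r| * ‖y‖ ^ r := le_mul_of_one_le_left (by positivity) (Real.one_le_rpow hM (abs_nonneg r))
  · rw [abs_of_nonpos hr]
    have : ‖x‖ ^ r ≤ (‖y‖ / M) ^ r := by
      apply Real.rpow_le_rpow_of_nonpos (by positivity) _ hr
      rw [div_le_iff₀ (by positivity)]; linarith
    refine this.trans_eq ?_
    rw [Real.div_rpow hy'.le (by positivity), Real.rpow_neg (by positivity)]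
    field_simp

lemma ball_bound {d : ℕ} (hd : 1 ≤ d) (t : ℝ) (ht : t < (d:ℝ) / 2) :
    ∃ c : ℝ≥0∞, c ≠ ⊤ ∧ ∀ b : Rd d, b ≠ 0 →
      ∫⁻ x, (Metric.closedBall (0 : Rd d) ‖b‖).indicator (pw (-2 * t)) x ≤ c * pw (d - 2 * t) b := by
  have : Nonempty (Fin d) := ⟨⟨0, hd⟩⟩
  refine ⟨∫⁻ x in Metric.ball (0 : Rd d) 2, pw (-2 * t) x, ?_, ?_⟩
  · have h : IntegrableOn (fun x : Rd d => ‖x‖ ^ (-2 * t)) (Metric.ball (0 : Rd d) 2) volume := by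
      rw [integrableOn_fun_norm_addHaar volume (f := fun y : ℝ => y ^ (-2 * t))]
      have h2 : IntegrableOn (fun y : ℝ => y ^ ((d:ℝ) - 1 - 2 * t)) (Set.Ioo 0 2) := by
        rw [intervalIntegral.integrableOn_Ioo_rpow_iff (by norm_num)]
        linarith
      refine h2.congr_fun (fun y hy => ?_) measurableSet_Ioo
      simp only [smul_eq_mul, finrank_euclideanSpace, Fintype.card_fin]
      rw [← Real.rpow_natCast, ← Real.rpow_add hy.1]
      congr 1
      push_cast [hd]
      ring
    have := h.lintegral_lt_top
    exact this.ne
  · intro b hb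
    have hb' := norm_pos_iff.2 hb
    have hmap := Measure.map_addHaar_smul (volume : Measure (Rd d)) hb'.ne'
    set f : Rd d → ℝ≥0∞ := (Metric.closedBall (0 : Rd d) ‖b‖).indicator (pw (-2 * t)) with hf
    have hfm : Measurable f := (measurable_pw _).indicator measurableSet_closedBall
    have e : ∫⁻ y, f (‖b‖ • y) = ENNReal.ofReal ((‖b‖ ^ d)⁻¹) * ∫⁻ x, f x := by
      rw [← lintegral_map hfm (measurable_const_smul ‖b‖), hmap, lintegral_smul_measure]
      simp
    have e2 : ∫⁻ x, f x = ENNReal.ofReal (‖b‖ ^ d) * ∫⁻ y, f (‖b‖ • y) := by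
      rw [e, ← mul_assoc, ← ENNReal.ofReal_mul (by positivity), mul_inv_cancel₀ (by positivity)]
      simp
    have e3 : ∫⁻ y, f (‖b‖ • y) ≤ pw (-2 * t) b * ∫⁻ x in Metric.ball (0 : Rd d) 2, pw (-2 * t) x := by
      rw [← lintegral_indicator measurableSet_ball, ← lintegral_const_mul]
      · refine lintegral_mono fun y => ?_
        simp only [hf]
        by_cases hy : ‖b‖ • y ∈ Metric.closedBall (0 : Rd d) ‖b‖
        · rw [Set.indicator_of_mem hy]
          have : y ∈ Metric.ball (0 : Rd d) 2 := by
            simp only [mem_closedBall_zero_iff, norm_smul, norm_norm] at hy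
            simp only [mem_ball_zero_iff]
            nlinarith
          rw [Set.indicator_of_mem this]
          unfold pw
          rw [← ENNReal.ofReal_mul (by positivity), norm_smul, norm_norm, Real.mul_rpow (by positivity) (by positivity)]
        · rw [Set.indicator_of_notMem hy]; exact zero_le
      · exact (measurable_pw _).indicator measurableSet_ball
    rw [e2]
    refine (mul_le_mul_right e3 _).trans_eq ?_
    have : ENNReal.ofReal (‖b‖ ^ d) = pw (d:ℝ) b := by simp [pw]
    rw [this, ← mul_assoc, pw_mul _ _ hb, mul_comm]
    congr 2; ring

/-- The region where `x j` is maximal (`j = i.succAbove j'`), and `x i` comparable to it. -/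
def regn {d m : ℕ} (i : Fin (m+2)) (j' : Fin (m+1)) : Set (Fin (m+2) → Rd d) :=
  {x | (∀ l, ‖x l‖ ≤ ‖x (i.succAbove j')‖) ∧ ‖x (i.succAbove j')‖ ≤ ((m:ℝ)+1) * ‖x i‖ ∧ ∀ l, x l ≠ 0}

lemma measurableSet_regn {d m : ℕ} (i : Fin (m+2)) (j' : Fin (m+1)) :
    MeasurableSet (regn (d := d) i j') := by
  unfold regn
  simp only [Set.ofPred_and, Set.ofPred_forall]
  refine (MeasurableSet.iInter fun l => measurableSet_le (by fun_prop) (by fun_prop)).inter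
    ((measurableSet_le (by fun_prop) (by fun_prop)).inter (MeasurableSet.iInter fun l => ?_))
  exact (measurableSet_singleton (0 : Rd d)).compl.preimage (measurable_pi_apply l)

lemma cover {d m : ℕ} (x : Fin (m+2) → Rd d) (hx : ∑ l, x l = 0) (h0 : ∀ l, x l ≠ 0) :
    ∃ i j', x ∈ regn i j' := by
  obtain ⟨j, hj⟩ := Finite.exists_max (fun l => ‖x l‖)
  have h1 : x j = -∑ l, x (j.succAbove l) := by
    rw [Fin.sum_univ_succAbove _ j] at hx
    exact eq_neg_of_add_eq_zero_left hx
  have h2 : ‖x j‖ ≤ ∑ l, ‖x (j.succAbove l)‖ := by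
    rw [h1, norm_neg]; exact norm_sum_le _ _
  have h3 : ∑ l : Fin (m+1), ‖x j‖ / ((m:ℝ)+1) ≤ ∑ l, ‖x (j.succAbove l)‖ := by
    refine le_trans (le_of_eq ?_) h2
    simp only [Finset.sum_const, Finset.card_univ, Fintype.card_fin, nsmul_eq_mul]
    push_cast
    field_simp
  obtain ⟨l, -, hl⟩ := Finset.exists_le_of_sum_le (Finset.univ_nonempty) h3
  obtain ⟨j', hj'⟩ := Fin.exists_succAbove_eq (Fin.succAbove_ne j l).symm
  refine ⟨j.succAbove l, j', ?_, ?_, h0⟩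
  · rw [hj']; exact hj
  · rw [hj']
    rw [div_le_iff₀ (by positivity)] at hl
    linarith

lemma region_bound {d m : ℕ} (hd : 1 ≤ d) (t : Fin (m+2) → ℝ) (ht : ∀ l, t l < (d:ℝ)/2)
    (hsum : ∑ l, t l = (m:ℝ) * d / 2) (i : Fin (m+2)) (j' : Fin (m+1)) :
    ∃ C : ℝ≥0∞, C ≠ ⊤ ∧ ∀ g : Fin (m+2) → Rd d → ℝ≥0∞, (∀ l, Measurable (g l)) →
      ∫⁻ v, (regn i j').indicator (fun x => ∏ l, g l (x l)) (hpar 0 v) ≤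
        C * ∏ l, (∫⁻ x, pw (2 * t l) x * g l x ^ 2) ^ (1/2 : ℝ) := by
  have : Nonempty (Fin d) := ⟨⟨0, hd⟩⟩
  choose c hc hcb using fun l => ball_bound hd (t l) (ht l)
  set j := i.succAbove j' with hj
  set K : ℝ≥0∞ := ENNReal.ofReal (((m:ℝ)+1) ^ |(-2 * t i)|) with hK
  set D : ℝ≥0∞ := K * ∏ l : Fin m, c (i.succAbove (j'.succAbove l)) with hD
  have hDtop : D ≠ ⊤ := ENNReal.mul_ne_top ENNReal.ofReal_ne_top (ENNReal.prod_ne_top fun l _ => hc _)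
  refine ⟨D ^ (1/2 : ℝ), ENNReal.rpow_ne_top_of_nonneg (by norm_num) hDtop, fun g hg => ?_⟩
  set F : (Fin (m+2) → Rd d) → ℝ≥0∞ := fun x =>
    ∏ l : Fin (m+1), (pw (t (j.succAbove l)) (x (j.succAbove l)) * g (j.succAbove l) (x (j.succAbove l))) with hF
  set G : (Fin (m+2) → Rd d) → ℝ≥0∞ := (regn i j').indicator (fun x =>
    g j (x j) * pw (t j) (x j) * ∏ l, pw (- t l) (x l)) with hG
  have hgc : ∀ l, Measurable (fun x : Fin (m+2) → Rd d => g l (x l)) :=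
    fun l => (hg l).comp (measurable_pi_apply l)
  have hpc : ∀ r l, Measurable (fun x : Fin (m+2) → Rd d => pw r (x l)) :=
    fun r l => (measurable_pw r).comp (measurable_pi_apply l)
  have hmg : ∀ l, Measurable (fun x => pw (2 * t l) x * g l x ^ 2) :=
    fun l => (measurable_pw _).mul ((hg _).pow_const 2)
  have hFm : Measurable F := by
    refine Finset.measurable_prod _ fun l _ => ?_
    exact Measurable.mul (hpc _ _) (hgc _)
  have hGm : Measurable G := by
    refine Measurable.indicator ?_ (measurableSet_regn i j')
    exact Measurable.mul (Measurable.mul (hgc _) (hpc _ _)) (Finset.measurable_prod _ fun l _ => hpc _ _)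
  have hcan : ∀ r (x : Rd d), x ≠ 0 → pw r x * pw (-r) x = 1 := by
    intro r x hx
    rw [pw_mul _ _ hx, add_neg_cancel, pw_zero]
  have hFG : ∀ x, (regn i j').indicator (fun x => ∏ l, g l (x l)) x = F x * G x := by
    intro x
    by_cases hx : x ∈ regn i j'
    · rw [hG, Set.indicator_of_mem hx, Set.indicator_of_mem hx, hF]
      simp only []
      rw [Fin.prod_univ_succAbove (fun l => g l (x l)) j,
        Fin.prod_univ_succAbove (fun l => pw (-t l) (x l)) j, Finset.prod_mul_distrib]
      have e1 : (∏ l : Fin (m+1), pw (t (j.succAbove l)) (x (j.succAbove l))) *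
          ∏ l : Fin (m+1), pw (-t (j.succAbove l)) (x (j.succAbove l)) = 1 := by
        rw [← Finset.prod_mul_distrib]
        exact Finset.prod_eq_one fun l _ => hcan _ _ (hx.2.2 _)
      have e2 := hcan (t j) (x j) (hx.2.2 _)
      set P1 := ∏ l : Fin (m+1), pw (t (j.succAbove l)) (x (j.succAbove l))
      set P2 := ∏ l : Fin (m+1), pw (-t (j.succAbove l)) (x (j.succAbove l))
      set P3 := ∏ l : Fin (m+1), g (j.succAbove l) (x (j.succAbove l))
      calc g j (x j) * P3 = g j (x j) * P3 * (P1 * P2) * (pw (t j) (x j) * pw (-t j) (x j)) := by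
            rw [e1, e2, mul_one, mul_one]
        _ = _ := by ring
    · rw [hG, Set.indicator_of_notMem hx, Set.indicator_of_notMem hx, mul_zero]
  have hCS := ENNReal.lintegral_mul_le_Lp_mul_Lq (volume : Measure (Fin (m+1) → Rd d))
    Real.HolderConjugate.two_two (hFm.comp (measurable_hpar 0)).aemeasurable
    (hGm.comp (measurable_hpar 0)).aemeasurable
  simp only [Pi.mul_apply, Function.comp_apply, ← hFG, ENNReal.rpow_two] at hCS
  refine hCS.trans ?_
  have hI1 : ∫⁻ v, F (hpar 0 v) ^ 2 = ∏ l : Fin (m+1), ∫⁻ x, pw (2 * t (j.succAbove l)) x * g (j.succAbove l) x ^ 2 := by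
    rw [hpar_zero_eq j (fun x => F x ^ 2) (hFm.pow_const 2),
      ← lprod (fun l x => pw (2 * t (j.succAbove l)) x * g (j.succAbove l) x ^ 2)
        (fun l => hmg _)]
    refine lintegral_congr fun v => ?_
    simp only [hF, hpar, Fin.insertNth_apply_succAbove]
    rw [← Finset.prod_pow]
    refine Finset.prod_congr rfl fun l _ => ?_
    rw [mul_pow, pw_sq]
  have hI2 : ∫⁻ v, G (hpar 0 v) ^ 2 ≤ D * ∫⁻ x, pw (2 * t j) x * g j x ^ 2 := by
    rw [hpar_zero_eq i (fun x => G x ^ 2) (hGm.pow_const 2),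
      lsplit j' (fun v => G (hpar i v) ^ 2) ((hGm.pow_const 2).comp (measurable_hpar i)),
      ← lintegral_const_mul _ (hmg j)]
    have hae : ∀ᵐ b : Rd d, b ≠ 0 := by
      simp [ae_iff]
    refine lintegral_mono_ae (hae.mono fun b hb => ?_)
    have hpt : ∀ y : Fin m → Rd d, G (hpar i (j'.insertNth b y)) ^ 2 ≤
        (K * pw (-2 * t i) b * pw (-2 * t j) b * (pw (2 * t j) b * g j b ^ 2)) *
        ∏ l, (Metric.closedBall (0 : Rd d) ‖b‖).indicator (pw (-2 * t (i.succAbove (j'.succAbove l)))) (y l) := by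
      intro y
      set x := hpar i (j'.insertNth b y) with hx
      have hxj : x j = b := by simp [hx, hpar, hj]
      have hxl : ∀ l, x (i.succAbove (j'.succAbove l)) = y l := by intro l; simp [hx, hpar]
      by_cases hxR : x ∈ regn i j'
      · rw [hG, Set.indicator_of_mem hxR, mul_pow, mul_pow, ← Finset.prod_pow]
        rw [Fin.prod_univ_succAbove _ i, Fin.prod_univ_succAbove _ j', ← hj]
        simp only [pw_sq, hxj, hxl]
        have hA : pw (2 * -t i) (x i) ≤ K * pw (-2 * t i) b := by
          have e : 2 * -t i = -2 * t i := by ring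
          rw [e]
          refine pw_comparable _ _ (by simp) (hxR.2.2 i) hb ?_ ?_
          · rw [← hxj]; exact hxR.1 i
          · have := hxR.2.1
            rw [← hj, hxj] at this
            exact this
        have hB : ∏ l, pw (2 * -t (i.succAbove (j'.succAbove l))) (y l) =
          ∏ l, (Metric.closedBall (0 : Rd d) ‖b‖).indicator (pw (-2 * t (i.succAbove (j'.succAbove l)))) (y l) := by
          refine Finset.prod_congr rfl fun l _ => ?_
          rw [Set.indicator_of_mem]
          · congr 1; ring
          · rw [mem_closedBall_zero_iff, ← hxl, ← hxj]
            exact hxR.1 _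
        rw [hB]
        have e : 2 * -t j = -2 * t j := by ring
        rw [e]
        set P := ∏ l, (Metric.closedBall (0 : Rd d) ‖b‖).indicator (pw (-2 * t (i.succAbove (j'.succAbove l)))) (y l)
        calc g j b ^ 2 * pw (2 * t j) b * (pw (2 * -t i) (x i) * (pw (-2 * t j) b * P))
            ≤ g j b ^ 2 * pw (2 * t j) b * (K * pw (-2 * t i) b * (pw (-2 * t j) b * P)) := by gcongr
          _ = _ := by ring
      · rw [hG, Set.indicator_of_notMem hxR]; simp
    refine (lintegral_mono hpt).trans ?_
    have hmi : ∀ l, Measurable ((Metric.closedBall (0 : Rd d) ‖b‖).indicator (pw (-2 * t (i.succAbove (j'.succAbove l))))) :=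
      fun l => (measurable_pw _).indicator measurableSet_closedBall
    have hmp : Measurable (fun y : Fin m → Rd d => ∏ l, (Metric.closedBall (0 : Rd d) ‖b‖).indicator
        (pw (-2 * t (i.succAbove (j'.succAbove l)))) (y l)) :=
      Finset.measurable_prod _ fun l _ => (hmi l).comp (measurable_pi_apply l)
    rw [lintegral_const_mul _ hmp, lprod _ hmi]
    have hprod : ∏ l, ∫⁻ x, (Metric.closedBall (0 : Rd d) ‖b‖).indicator (pw (-2 * t (i.succAbove (j'.succAbove l)))) x
        ≤ (∏ l, c (i.succAbove (j'.succAbove l))) * pw (∑ l : Fin m, (d - 2 * t (i.succAbove (j'.succAbove l)))) b := by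
      rw [← pw_prod _ _ hb, ← Finset.prod_mul_distrib]
      exact Finset.prod_le_prod' fun l _ => hcb _ b hb
    have hone : pw (-2 * t i) b * pw (-2 * t j) b * pw (∑ l : Fin m, (d - 2 * t (i.succAbove (j'.succAbove l)))) b = 1 := by
      rw [pw_mul _ _ hb, pw_mul _ _ hb]
      rw [Fin.sum_univ_succAbove _ i, Fin.sum_univ_succAbove _ j', ← hj] at hsum
      rw [Finset.sum_sub_distrib, ← Finset.mul_sum]
      simp only [Finset.sum_const, Finset.card_univ, Fintype.card_fin, nsmul_eq_mul]
      convert pw_zero b using 2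
      linarith
    refine (mul_le_mul_right hprod _).trans_eq ?_
    rw [hD]
    set Pc := ∏ l, c (i.succAbove (j'.succAbove l))
    set W := pw (∑ l : Fin m, (d - 2 * t (i.succAbove (j'.succAbove l)))) b
    calc K * pw (-2 * t i) b * pw (-2 * t j) b * (pw (2 * t j) b * g j b ^ 2) * (Pc * W)
        = K * Pc * (pw (2 * t j) b * g j b ^ 2) * (pw (-2 * t i) b * pw (-2 * t j) b * W) := by ring
      _ = _ := by rw [hone, mul_one]
  rw [hI1, Fin.prod_univ_succAbove (fun l => (∫⁻ x, pw (2 * t l) x * g l x ^ 2) ^ (1/2 : ℝ)) j]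
  rw [ENNReal.prod_rpow_of_nonneg (by norm_num)]
  calc _ ≤ (∏ l : Fin (m+1), (∫⁻ x, pw (2 * t (j.succAbove l)) x * g (j.succAbove l) x ^ 2)) ^ (1/2:ℝ) *
        (D * ∫⁻ x, pw (2 * t j) x * g j x ^ 2) ^ (1/2:ℝ) := by gcongr
    _ = _ := by
      rw [ENNReal.mul_rpow_of_nonneg _ _ (by norm_num)]
      ring

lemma form_bound {d m : ℕ} (hd : 1 ≤ d) (t : Fin (m+2) → ℝ) (ht : ∀ l, t l < (d:ℝ)/2)
    (hsum : ∑ l, t l = (m:ℝ) * d / 2) :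
    ∃ C : ℝ≥0∞, C ≠ ⊤ ∧ ∀ g : Fin (m+2) → Rd d → ℝ≥0∞, (∀ l, Measurable (g l)) →
      ∫⁻ v, ∏ l, g l (hpar 0 v l) ≤
        C * ∏ l, (∫⁻ x, pw (2 * t l) x * g l x ^ 2) ^ (1/2 : ℝ) := by
  have : Nonempty (Fin d) := ⟨⟨0, hd⟩⟩
  choose C hC hCb using fun i j' => region_bound hd t ht hsum i j'
  refine ⟨∑ i, ∑ j', C i j', ?_, fun g hg => ?_⟩
  · simp only [ne_eq, ENNReal.sum_eq_top, not_exists, not_and]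
    intro i _ j' _
    exact hC i j'
  have hgm : Measurable (fun x : Fin (m+2) → Rd d => ∏ l, g l (x l)) :=
    Finset.measurable_prod _ fun l _ => (hg l).comp (measurable_pi_apply l)
  have hind : ∀ i j', Measurable (fun v => (regn i j').indicator (fun x : Fin (m+2) → Rd d => ∏ l, g l (x l)) (hpar 0 v)) :=
    fun i j' => (hgm.indicator (measurableSet_regn i j')).comp (measurable_hpar 0)
  have hae : ∀ l : Fin (m+2), ∀ᵐ v : Fin (m+1) → Rd d, hpar 0 v l ≠ 0 := by
    intro l
    obtain ⟨i, hi⟩ : ∃ i : Fin (m+2), l ≠ i := exists_ne l |>.imp fun _ h => h.symm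
    obtain ⟨l', rfl⟩ := Fin.exists_succAbove_eq hi
    have hms : MeasurableSet {x : Fin (m+2) → Rd d | x (i.succAbove l') = 0} :=
      (measurableSet_singleton (0 : Rd d)).preimage (measurable_pi_apply _)
    have h0 : ∫⁻ v : Fin (m+1) → Rd d, {x : Fin (m+2) → Rd d | x (i.succAbove l') = 0}.indicator (fun _ => (1:ℝ≥0∞)) (hpar 0 v) = 0 := by
      rw [hpar_zero_eq i _ (measurable_const.indicator hms)]
      have : ∀ᵐ v : Fin (m+1) → Rd d, v l' ≠ 0 := by
        rw [ae_iff]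
        simp only [ne_eq, not_not]
        rw [MeasureTheory.volume_pi]
        exact Measure.pi_hyperplane _ l' 0
      refine (lintegral_eq_zero_iff ((measurable_const.indicator hms).comp (measurable_hpar i))).2 ?_
      filter_upwards [this] with v hv
      simp [hpar, hv]
    replace h0 := (lintegral_eq_zero_iff ((measurable_const.indicator hms).comp (measurable_hpar 0))).1 h0
    filter_upwards [h0] with v hv h
    have : hpar 0 v ∈ {x : Fin (m+2) → Rd d | x (i.succAbove l') = 0} := h
    simp only [Function.comp_apply, Set.indicator_of_mem this] at hv
    simp at hv
  calc ∫⁻ v, ∏ l, g l (hpar 0 v l) ≤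
      ∫⁻ v, ∑ i, ∑ j', (regn i j').indicator (fun x => ∏ l, g l (x l)) (hpar 0 v) := by
        refine lintegral_mono_ae ?_
        filter_upwards [ae_all_iff.2 hae] with v hv
        obtain ⟨i, j', hij⟩ := cover (hpar 0 v) (hpar_sum 0 v) hv
        refine le_trans ?_ (Finset.single_le_sum (fun _ _ => zero_le) (Finset.mem_univ i))
        refine le_trans ?_ (Finset.single_le_sum (fun _ _ => zero_le) (Finset.mem_univ j'))
        rw [Set.indicator_of_mem hij]
    _ = ∑ i, ∑ j', ∫⁻ v, (regn i j').indicator (fun x => ∏ l, g l (x l)) (hpar 0 v) := by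
        rw [lintegral_finsetSum _ fun i _ => Finset.measurable_sum _ fun j' _ => hind i j']
        refine Finset.sum_congr rfl fun i _ => ?_
        rw [lintegral_finsetSum _ fun j' _ => hind i j']
    _ ≤ ∑ i, ∑ j', C i j' * ∏ l, (∫⁻ x, pw (2 * t l) x * g l x ^ 2) ^ (1/2 : ℝ) :=
        Finset.sum_le_sum fun i _ => Finset.sum_le_sum fun j' _ => hCb i j' g hg
    _ = _ := by simp_rw [← Finset.sum_mul]

lemma dual_bound {d : ℕ} (H : Rd d → ℝ≥0∞) (hH : Measurable H) (M : ℝ≥0∞)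
    (h : ∀ f : Rd d → ℝ≥0∞, Measurable f → ∫⁻ x, f x * H x ≤ M * (∫⁻ x, f x ^ 2) ^ (1/2 : ℝ)) :
    ∫⁻ x, H x ^ 2 ≤ M ^ 2 := by
  set f : ℕ → Rd d → ℝ≥0∞ := fun n => (Metric.ball (0 : Rd d) n).indicator (fun x => min (H x) n) with hf
  have hfm : ∀ n, Measurable (f n) := fun n => (hH.min measurable_const).indicator measurableSet_ball
  have hfH : ∀ n x, f n x ≤ H x := by
    intro n x
    simp only [hf]
    refine (Set.indicator_le_self' (fun _ _ => zero_le) x).trans (min_le_left _ _)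
  have hfin : ∀ n, ∫⁻ x, f n x ^ 2 ≠ ⊤ := by
    intro n
    have : ∫⁻ x, f n x ^ 2 ≤ ∫⁻ x, (Metric.ball (0 : Rd d) n).indicator (fun _ => (n : ℝ≥0∞) ^ 2) x := by
      refine lintegral_mono fun x => ?_
      simp only [hf]
      by_cases hx : x ∈ Metric.ball (0 : Rd d) n
      · rw [Set.indicator_of_mem hx, Set.indicator_of_mem hx]
        gcongr
        exact min_le_right _ _
      · rw [Set.indicator_of_notMem hx, Set.indicator_of_notMem hx]; simp
    refine ne_top_of_le_ne_top ?_ this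
    rw [lintegral_indicator_const measurableSet_ball]
    exact ENNReal.mul_ne_top (by simp) measure_ball_lt_top.ne
  have hbd : ∀ n, ∫⁻ x, f n x ^ 2 ≤ M ^ 2 := by
    intro n
    have h1 : ∫⁻ x, f n x ^ 2 ≤ M * (∫⁻ x, f n x ^ 2) ^ (1/2 : ℝ) := by
      refine le_trans (lintegral_mono fun x => ?_) (h (f n) (hfm n))
      rw [sq]
      gcongr
      exact hfH n x
    set Q := ∫⁻ x, f n x ^ 2 with hQ
    set q := Q ^ (1/2 : ℝ) with hq
    have hqq : Q = q ^ 2 := by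
      rw [hq, ← ENNReal.rpow_two, ← ENNReal.rpow_mul]; norm_num
    have hqt : q ≠ ⊤ := ENNReal.rpow_ne_top_of_nonneg (by norm_num) (hfin n)
    rw [hqq] at h1 ⊢
    by_cases hq0 : q = 0
    · simp [hq0]
    · rw [sq] at h1
      have := (ENNReal.mul_le_mul_iff_left hq0 hqt).1 h1
      gcongr
  have hlim : ∀ x, Tendsto (fun n => f n x ^ 2) atTop (𝓝 (H x ^ 2)) := by
    intro x
    refine ENNReal.Tendsto.pow ?_
    have h1 : Tendsto (fun n : ℕ => min (H x) (n : ℝ≥0∞)) atTop (𝓝 (H x)) := by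
      have := (tendsto_const_nhds (x := H x) (f := (atTop : Filter ℕ))).min ENNReal.tendsto_nat_nhds_top
      simpa using this
    refine h1.congr' ?_
    obtain ⟨N, hN⟩ := exists_nat_gt ‖x‖
    filter_upwards [eventually_ge_atTop N] with n hn
    simp only [hf]
    rw [Set.indicator_of_mem]
    rw [mem_ball_zero_iff]
    exact hN.trans_le (by exact_mod_cast hn)
  calc ∫⁻ x, H x ^ 2 = ∫⁻ x, liminf (fun n => f n x ^ 2) atTop :=
        lintegral_congr fun x => (hlim x).liminf_eq.symm
    _ ≤ liminf (fun n => ∫⁻ x, f n x ^ 2) atTop := lintegral_liminf_le fun n => (hfm n).pow_const 2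
    _ ≤ liminf (fun _ : ℕ => M ^ 2) atTop := liminf_le_liminf (Eventually.of_forall hbd)
    _ = M ^ 2 := by simp

lemma measurable_multiConvE {d m : ℕ} (g : Fin (m + 1) → Rd d → ℝ≥0∞) (hg : ∀ l, Measurable (g l)) :
    Measurable (multiConvE d m g) := by
  have hm : Measurable (fun p : Rd d × (Fin m → Rd d) => (∏ i : Fin m, g i.castSucc (p.2 i)) * g (Fin.last m) (p.1 - ∑ i, p.2 i)) := by
    apply Measurable.mul
    · exact Finset.measurable_prod _ (fun i _ => (hg _).comp (by fun_prop))
    · exact (hg _).comp (by fun_prop)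
  exact hm.lintegral_prod_right'

lemma weighted_bound {d m : ℕ} (hd : 1 ≤ d) (s : ℝ)
    (hs1 : (d:ℝ) / 2 - (d:ℝ) / ((m:ℝ) + 1) < s) (hs2 : s < (d:ℝ) / 2) :
    ∃ C : ℝ≥0∞, C ≠ ⊤ ∧ ∀ g : Fin (m + 1) → Rd d → ℝ≥0∞, (∀ l, Measurable (g l)) →
      ∫⁻ ξ, (pw (((m:ℝ) + 1) * s - (m:ℝ) * (d:ℝ) / 2) ξ * multiConvE d m g ξ) ^ 2 ≤
        (C * ∏ l, (∫⁻ x, pw (2 * s) x * g l x ^ 2) ^ (1/2 : ℝ)) ^ 2 := by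
  have : Nonempty (Fin d) := ⟨⟨0, hd⟩⟩
  set σ : ℝ := ((m:ℝ) + 1) * s - (m:ℝ) * (d:ℝ) / 2 with hσ
  have hσ1 : -σ < (d:ℝ) / 2 := by
    have h1 : ((d:ℝ) / 2 - (d:ℝ) / ((m:ℝ) + 1)) * ((m:ℝ) + 1) < s * ((m:ℝ) + 1) :=
      mul_lt_mul_of_pos_right hs1 (by positivity)
    have h2 : ((d:ℝ) / 2 - (d:ℝ) / ((m:ℝ) + 1)) * ((m:ℝ) + 1) = (d:ℝ) / 2 * (m + 1) - d := by
      field_simp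
    rw [h2] at h1
    rw [hσ]
    linarith
  obtain ⟨C, hC, hCb⟩ := form_bound (m := m) hd (Fin.cons (-σ) (fun _ => s))
    (fun l => Fin.cases (by simpa using hσ1) (fun j => by simpa using hs2) l)
    (by
      rw [Fin.sum_univ_succ]
      simp only [Fin.cons_zero, Fin.cons_succ, Finset.sum_const, Finset.card_univ, Fintype.card_fin, nsmul_eq_mul]
      push_cast
      rw [hσ]; ring)
  refine ⟨C, hC, fun g hg => ?_⟩
  refine dual_bound _ ((measurable_pw _).mul (measurable_multiConvE g hg)) _ fun f hf => ?_
  have hφ : Measurable (fun x => f x * pw σ x) := hf.mul (measurable_pw _)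
  have h1 := hCb (Fin.cons (fun x => f (-x) * pw σ (-x)) g)
    (fun l => Fin.cases (hφ.comp measurable_neg) (fun j => hg j) l)
  have h2 := form_eq g hg _ hφ
  rw [← h2] at h1
  simp only [Fin.prod_univ_succ (n := m + 1), Fin.cons_zero, Fin.cons_succ] at h1
  have h3 : ∫⁻ x : Rd d, pw (2 * -σ) x * (f (-x) * pw σ (-x)) ^ 2 = ∫⁻ x, f x ^ 2 := by
    rw [← lintegral_neg_eq_self (fun x : Rd d => f x ^ 2)]
    have hae : ∀ᵐ b : Rd d, b ≠ 0 := by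
      simp [ae_iff]
    refine lintegral_congr_ae (hae.mono fun x hx => ?_)
    have e : pw σ (-x) = pw σ x := by simp [pw]
    simp only []
    rw [e, mul_pow, pw_sq, mul_comm (f (-x) ^ 2), ← mul_assoc, pw_mul _ _ hx]
    have : 2 * -σ + 2 * σ = 0 := by ring
    rw [this, pw_zero, one_mul]
  rw [h3] at h1
  refine le_trans (le_of_eq (lintegral_congr fun x => ?_)) (h1.trans_eq ?_)
  · show f x * (pw _ x * _) = _
    ring
  · ring

/-- Fourier-side form of the product law.  Let `d ≥ 1`, `k = m+1 ≥ 2`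
and `d/2 − d/k < s < d/2`.  There is `C = C(d,k,s)` such that for any measurable
`g₁, …, g_k : ℝ^d → [0,∞]` with `∫ |ξ|^{2s} g_ℓ(ξ)² dξ < ∞`, there is `f ∈ L²` with
`‖f‖_{L²} ≤ 1` and, for a.e. `ξ`,
`(g₁ ⋆ ⋯ ⋆ g_k)(ξ) ≤ C |ξ|^{−(ks−(k−1)d/2)} f(ξ) ∏_ℓ (∫ |η|^{2s} g_ℓ(η)² dη)^{1/2}`. -/
theorem statement9 (d m : ℕ) (hd : 1 ≤ d) (hm : 1 ≤ m) (s : ℝ)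
    (hs1 : (d:ℝ) / 2 - (d:ℝ) / ((m:ℝ) + 1) < s) (hs2 : s < (d:ℝ) / 2) :
    ∃ C > (0:ℝ), ∀ g : Fin (m + 1) → Rd d → ℝ≥0∞,
      (∀ ℓ, Measurable (g ℓ)) →
      (∀ ℓ, (∫⁻ η : Rd d, ENNReal.ofReal (‖η‖ ^ (2 * s)) * g ℓ η ^ 2) < ⊤) →
      ∃ f : Rd d → ℝ, MeasureTheory.MemLp f 2 volume ∧ eLpNorm f 2 volume ≤ 1 ∧
        ∀ᵐ ξ : Rd d, multiConvE d m g ξ ≤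
          ENNReal.ofReal (C * ‖ξ‖ ^ (-(((m:ℝ) + 1) * s - (m:ℝ) * (d:ℝ) / 2)) * f ξ) *
            ∏ ℓ : Fin (m + 1),
              (∫⁻ η : Rd d, ENNReal.ofReal (‖η‖ ^ (2 * s)) * g ℓ η ^ 2) ^ (1/2 : ℝ) := by
  have : Nonempty (Fin d) := ⟨⟨0, hd⟩⟩
  obtain ⟨C0, hC0, hb⟩ := weighted_bound (m := m) hd s hs1 hs2
  refine ⟨C0.toReal + 1, by positivity, fun g hg hfin => ?_⟩
  set σ : ℝ := ((m:ℝ) + 1) * s - (m:ℝ) * (d:ℝ) / 2 with hσ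
  set C : ℝ := C0.toReal + 1 with hC
  have hCpos : 0 < C := by positivity
  have hae : ∀ᵐ b : Rd d, b ≠ 0 := by
    simp [ae_iff]
  set P : ℝ≥0∞ := ∏ ℓ : Fin (m + 1),
    (∫⁻ η : Rd d, ENNReal.ofReal (‖η‖ ^ (2 * s)) * g ℓ η ^ 2) ^ (1/2 : ℝ) with hP
  have hPt : P ≠ ⊤ := ENNReal.prod_ne_top fun l _ =>
    ENNReal.rpow_ne_top_of_nonneg (by norm_num) (hfin l).ne
  set H : Rd d → ℝ≥0∞ := fun ξ => pw σ ξ * multiConvE d m g ξ with hH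
  have hHm : Measurable H := (measurable_pw _).mul (measurable_multiConvE g hg)
  set M : ℝ≥0∞ := ENNReal.ofReal C * P with hM
  have hMt : M ≠ ⊤ := ENNReal.mul_ne_top ENNReal.ofReal_ne_top hPt
  have hHM : ∫⁻ ξ, H ξ ^ 2 ≤ M ^ 2 := by
    refine (hb g hg).trans ?_
    have : C0 ≤ ENNReal.ofReal C := by
      rw [← ENNReal.ofReal_toReal hC0]
      exact ENNReal.ofReal_le_ofReal (by simp [hC])
    exact pow_le_pow_left' (mul_le_mul_left this _) 2
  have hrec : ∀ ξ : Rd d, ξ ≠ 0 → pw (-σ) ξ * H ξ = multiConvE d m g ξ := by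
    intro ξ hξ
    simp only [hH]
    rw [← mul_assoc, pw_mul _ _ hξ, neg_add_cancel, pw_zero, one_mul]
  by_cases hP0 : P = 0
  · refine ⟨0, MemLp.zero, by simp, ?_⟩
    have hM0 : M = 0 := by simp [hM, hP0]
    have h0 : ∫⁻ ξ, H ξ ^ 2 = 0 := by
      rw [hM0] at hHM
      simpa using hHM
    rw [lintegral_eq_zero_iff (hHm.pow_const 2)] at h0
    filter_upwards [h0, hae] with ξ h1 h2
    have h3 : H ξ = 0 := by simpa using h1
    rw [← hrec ξ h2, h3]
    simp
  · have hM0 : M ≠ 0 := mul_ne_zero (by simpa using hCpos) hP0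
    have hfm : Measurable (fun ξ => (H ξ / M).toReal) := (hHm.div_const M).ennreal_toReal
    have hnorm : eLpNorm (fun ξ => (H ξ / M).toReal) 2 volume ≤ 1 := by
      rw [eLpNorm_eq_lintegral_rpow_enorm_toReal (by norm_num) (by norm_num)]
      refine ENNReal.rpow_le_one ?_ (by positivity)
      calc ∫⁻ ξ, ‖(H ξ / M).toReal‖ₑ ^ (2 : ℝ≥0∞).toReal ≤ ∫⁻ ξ, H ξ ^ 2 * (M⁻¹) ^ 2 := by
            refine lintegral_mono fun ξ => ?_
            simp only [ENNReal.toReal_ofNat, ENNReal.rpow_two]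
            rw [← mul_pow, ← div_eq_mul_inv]
            gcongr
            rw [Real.enorm_eq_ofReal ENNReal.toReal_nonneg]
            exact ENNReal.ofReal_toReal_le
        _ = (∫⁻ ξ, H ξ ^ 2) * (M⁻¹) ^ 2 := lintegral_mul_const _ (hHm.pow_const 2)
        _ ≤ M ^ 2 * (M⁻¹) ^ 2 := by gcongr
        _ = 1 := by rw [← mul_pow, ENNReal.mul_inv_cancel hM0 hMt, one_pow]
    refine ⟨fun ξ => (H ξ / M).toReal, ⟨hfm.aestronglyMeasurable, hnorm.trans_lt ENNReal.one_lt_top⟩, hnorm, ?_⟩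
    have hlt : ∀ᵐ ξ, H ξ ^ 2 < ⊤ := ae_lt_top (hHm.pow_const 2)
      (ne_top_of_le_ne_top (ENNReal.pow_ne_top hMt) hHM)
    filter_upwards [hlt, hae] with ξ h1 h2
    have h3 : H ξ ≠ ⊤ := by
      intro h
      rw [h] at h1
      simp at h1
    rw [ENNReal.ofReal_mul (by positivity), ENNReal.ofReal_mul hCpos.le,
      ENNReal.ofReal_toReal (ENNReal.div_ne_top h3 hM0), ← hrec ξ h2]
    refine le_of_eq ?_
    have e : ENNReal.ofReal (‖ξ‖ ^ (-σ)) = pw (-σ) ξ := rfl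
    rw [e]
    calc pw (-σ) ξ * H ξ = pw (-σ) ξ * H ξ * (M * M⁻¹) := by
          rw [ENNReal.mul_inv_cancel hM0 hMt, mul_one]
      _ = pw (-σ) ξ * H ξ * (ENNReal.ofReal C * P * M⁻¹) := by rw [← hM]
      _ = _ := by rw [div_eq_mul_inv]; ring

end
end

section
/- Let d ≥ 1, ε > 0, s_crit < d/2 and p ∈ (2,∞) [so that 2/p > 0]. For every U₀ with ‖U₀‖_{Ḣ^{s_crit}(ℝ^d)} < ∞, one has lim_{T→0⁺} sup_{0<t≤T} t^{1/p} ‖e^{εtΔ} U₀‖_{Ḣ^{s_crit+2/p}} = 0. -/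
open MeasureTheory Real Filter Topology
open scoped ENNReal NNReal

noncomputable section

/-- vanishing of the Kato norm of the free evolution for critical data,
(2.9).  Let `d ≥ 1`, `ε > 0`, `s_crit < d/2` and `p ∈ (2,∞)`.  For every
`U₀ ∈ Ḣ^{s_crit}(ℝ^d)`, `lim_{T→0⁺} sup_{0<t≤T} t^{1/p} ‖e^{εtΔ}U₀‖_{Ḣ^{s_crit+2/p}} = 0`. -/
theorem statement11 (d N : ℕ) (hd : 1 ≤ d) (ε : ℝ) (hε : 0 < ε)
    (scrit : ℝ) (hs : scrit < (d:ℝ) / 2) (p : ℝ) (hp : 2 < p)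
    (U₀ : Rd d → CN N) (hU₀meas : ∀ j : Fin N, Measurable fun ξ => U₀ ξ j)
    (hU₀ : hSob d N scrit U₀ < ⊤) :
    Filter.Tendsto (fun T : ℝ => heatKato d N ε scrit p T U₀) (𝓝[>] (0:ℝ)) (𝓝 0) := by
  have hp0 : 0 < p := by linarith
  have ha1 : 2 / p ≤ 1 := by rw [div_le_one hp0]; linarith
  have ha0 : 0 < 2 / p := by positivity
  have hUm : Measurable U₀ := by
    have h1 : Measurable fun ξ => (WithLp.ofLp (U₀ ξ) : Fin N → ℂ) :=
      measurable_pi_iff.mpr hU₀meas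
    exact (WithLp.measurable_toLp 2 (Fin N → ℂ)).comp h1
  haveI : Nonempty (Fin d) := ⟨⟨0, hd⟩⟩
  haveI : Nontrivial (Rd d) := inferInstance
  have hI : ∫⁻ ξ : Rd d, ENNReal.ofReal (‖ξ‖ ^ (2 * scrit) * ‖U₀ ξ‖ ^ 2) ≠ ⊤ := by
    intro h
    rw [hSob, h, ENNReal.top_rpow_of_pos (by norm_num)] at hU₀
    exact lt_irrefl _ hU₀
  have hne : ∀ᵐ ξ : Rd d, ξ ≠ 0 := by
    rw [ae_iff]; simp
  -- pointwise identity
  have key : ∀ t : ℝ, 0 < t → ∀ ξ : Rd d, ξ ≠ 0 →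
      t ^ (2 / p) * (‖ξ‖ ^ (2 * (scrit + 2 / p)) * ‖heatHat d N (ε * t) U₀ ξ‖ ^ 2) =
      ((t * ‖ξ‖ ^ 2) ^ (2 / p) * Real.exp (-(2 * ε * (t * ‖ξ‖ ^ 2)))) *
        (‖ξ‖ ^ (2 * scrit) * ‖U₀ ξ‖ ^ 2) := by
    intro t ht ξ hξ
    have hn : 0 < ‖ξ‖ := norm_pos_iff.mpr hξ
    have e1 : ‖heatHat d N (ε * t) U₀ ξ‖ ^ 2 =
        Real.exp (-(2 * ε * (t * ‖ξ‖ ^ 2))) * ‖U₀ ξ‖ ^ 2 := by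
      rw [heatHat, norm_smul, mul_pow, Real.norm_eq_abs, sq_abs, ← Real.exp_nat_mul]
      congr 2
      push_cast; ring
    have e2 : ‖ξ‖ ^ (2 * (scrit + 2 / p)) = ‖ξ‖ ^ (2 * scrit) * (‖ξ‖ ^ 2) ^ (2 / p) := by
      rw [mul_add, Real.rpow_add hn, Real.rpow_mul hn.le 2 (2 / p), Real.rpow_two]
    rw [e1, e2, Real.mul_rpow ht.le (by positivity)]
    ring
  have bnd : ∀ x : ℝ, 0 < x → x ^ (2 / p) * Real.exp (-(2 * ε * x)) ≤ 1 + 1 / (2 * ε) := by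
    intro x hx
    have h1 : x ^ (2 / p) ≤ 1 + x := by
      rcases le_total x 1 with h | h
      · have := Real.rpow_le_one hx.le h ha0.le
        linarith
      · have := Real.rpow_le_rpow_of_exponent_le h ha1
        rw [Real.rpow_one] at this
        linarith
    have h2 : Real.exp (-(2 * ε * x)) ≤ 1 := Real.exp_le_one_iff.mpr (by
      have : 0 < 2 * ε * x := by positivity
      linarith)
    have h3 : x * Real.exp (-(2 * ε * x)) ≤ 1 / (2 * ε) := by
      rw [Real.exp_neg, ← div_eq_mul_inv, div_le_div_iff₀ (Real.exp_pos _) (by positivity)]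
      have := Real.add_one_le_exp (2 * ε * x)
      linarith
    calc _ ≤ (1 + x) * Real.exp (-(2 * ε * x)) := by gcongr
      _ = Real.exp (-(2 * ε * x)) + x * Real.exp (-(2 * ε * x)) := by ring
      _ ≤ _ := by linarith
  have hlim : Tendsto (fun t : ℝ => ∫⁻ ξ : Rd d, ENNReal.ofReal
      (t ^ (2 / p) * (‖ξ‖ ^ (2 * (scrit + 2 / p)) * ‖heatHat d N (ε * t) U₀ ξ‖ ^ 2)))
      (𝓝[>] (0:ℝ)) (𝓝 (∫⁻ _ : Rd d, 0)) := by
    refine tendsto_lintegral_filter_of_dominated_convergence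
      (fun ξ => ENNReal.ofReal (1 + 1 / (2 * ε)) *
        ENNReal.ofReal (‖ξ‖ ^ (2 * scrit) * ‖U₀ ξ‖ ^ 2)) ?_ ?_ ?_ ?_
    · refine Eventually.of_forall fun t => ?_
      unfold heatHat
      fun_prop
    · filter_upwards [self_mem_nhdsWithin] with t ht
      filter_upwards [hne] with ξ hξ
      have hn : 0 < ‖ξ‖ := norm_pos_iff.mpr hξ
      have ht : 0 < t := ht
      rw [key t ht ξ hξ, ← ENNReal.ofReal_mul (by positivity)]
      apply ENNReal.ofReal_le_ofReal
      exact mul_le_mul_of_nonneg_right (bnd _ (by positivity)) (by positivity)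
    · rw [lintegral_const_mul' _ _ ENNReal.ofReal_ne_top]
      exact ENNReal.mul_ne_top ENNReal.ofReal_ne_top hI
    · filter_upwards [hne] with ξ hξ
      rw [← ENNReal.ofReal_zero]
      apply ENNReal.tendsto_ofReal
      have hc : Tendsto (fun t : ℝ => ((t * ‖ξ‖ ^ 2) ^ (2 / p) *
          Real.exp (-(2 * ε * (t * ‖ξ‖ ^ 2)))) * (‖ξ‖ ^ (2 * scrit) * ‖U₀ ξ‖ ^ 2))
          (𝓝[>] (0:ℝ)) (𝓝 0) := by
        have hcont : Continuous (fun t : ℝ => ((t * ‖ξ‖ ^ 2) ^ (2 / p) *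
          Real.exp (-(2 * ε * (t * ‖ξ‖ ^ 2)))) * (‖ξ‖ ^ (2 * scrit) * ‖U₀ ξ‖ ^ 2)) := by
          have : Continuous (fun t : ℝ => (t * ‖ξ‖ ^ 2) ^ (2 / p)) :=
            (continuous_id.mul continuous_const).rpow_const (fun _ => Or.inr ha0.le)
          fun_prop
        have := (hcont.tendsto 0).mono_left (nhdsWithin_le_nhds (s := Set.Ioi 0))
        simpa [Real.zero_rpow ha0.ne'] using this
      refine hc.congr' ?_
      filter_upwards [self_mem_nhdsWithin] with t ht
      exact (key t ht ξ hξ).symm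
  rw [lintegral_zero] at hlim
  have hlim2 : Tendsto (fun t : ℝ => ENNReal.ofReal (t ^ (1/p)) *
      hSob d N (scrit + 2/p) (heatHat d N (ε * t) U₀)) (𝓝[>] (0:ℝ)) (𝓝 0) := by
    have h := hlim.ennrpow_const (1/2 : ℝ)
    rw [ENNReal.zero_rpow_of_pos (by norm_num)] at h
    refine h.congr' ?_
    filter_upwards [self_mem_nhdsWithin] with t ht
    have ht : 0 < t := ht
    have e : ∀ ξ : Rd d, ENNReal.ofReal
        (t ^ (2 / p) * (‖ξ‖ ^ (2 * (scrit + 2 / p)) * ‖heatHat d N (ε * t) U₀ ξ‖ ^ 2)) =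
        ENNReal.ofReal (t ^ (2 / p)) * ENNReal.ofReal
          (‖ξ‖ ^ (2 * (scrit + 2 / p)) * ‖heatHat d N (ε * t) U₀ ξ‖ ^ 2) := fun ξ =>
      ENNReal.ofReal_mul (by positivity)
    simp_rw [e]
    rw [lintegral_const_mul' _ _ ENNReal.ofReal_ne_top,
      ENNReal.mul_rpow_of_nonneg _ _ (by norm_num), hSob,
      ENNReal.ofReal_rpow_of_pos (by positivity), ← Real.rpow_mul ht.le]
    congr 3
    ring_nf
  rw [ENNReal.tendsto_nhds_zero] at hlim2 ⊢
  intro δ hδ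
  have h := hlim2 δ hδ
  rw [eventually_nhdsWithin_iff, Metric.eventually_nhds_iff] at h
  obtain ⟨r, hr, h⟩ := h
  filter_upwards [Ioo_mem_nhdsGT hr] with T hT
  refine iSup₂_le fun τ hτ => h ?_ hτ.1
  rw [Real.dist_eq, sub_zero, abs_of_pos hτ.1]
  exact lt_of_le_of_lt hτ.2 hT.2

end
end

section
/- Let ε ∈ (0,1), λ > 0, T > 0, t₀ ≥ 0 and p ∈ (2,∞). Suppose u, defined for t ∈ (t₀, t₀+T], satisfies for all such t and all ξ ∈ ℝ³: |û(t,ξ)| ≤ e^{−(t−t₀)|ξ|²} |û(t₀,ξ)| + C₀ ∫_{t₀}^t e^{−(t−t')|ξ|²} |ξ| ( |û(t')| ⋆ |û(t')| )(ξ) dt'. Define u_{a,t₀}(t) = F^{−1}( e^{−λ²(t−t₀)/(4(1−ε)T) + λ(t−t₀)|ξ|/√T} |û(t,ξ)| ) and ‖v‖_{K^p_{t₀,T}} = sup_{t₀<t≤t₀+T} (t−t₀)^{1/p} ‖v(t)‖_{Ḣ^{1/2+2/p}(ℝ³)}. Then there exists C_ε > 0 (depending only on p, ε, C₀) such that ‖u_{a,t₀}‖_{K^p_{t₀,T}}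 ≤ ‖e^{ε(t−t₀)Δ} u(t₀)‖_{K^p_{t₀,T}} + C_ε e^{λ²/(4(1−ε))} ‖u_{a,t₀}‖_{K^p_{t₀,T}}². -/
open MeasureTheory Real Filter Topology
open scoped ENNReal NNReal

noncomputable section

/-- Convolution of two complex-valued functions on `ℝ³`. -/
def conv2C (f g : Rd 3 → ℂ) (ξ : Rd 3) : ℂ :=
  ∫ η : Rd 3, f η * g (ξ - η)

/-- Convolution of two nonnegative (extended-real-valued) functions on `ℝ³`. -/
def conv2E (f g : Rd 3 → ℝ≥0∞) (ξ : Rd 3) : ℝ≥0∞ :=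
  ∫⁻ η : Rd 3, f η * g (ξ - η)

/-- Fourier-side formulation of a mild solution of the 3D incompressible Navier–Stokes
equations on `[t₀,∞)`: for `t > t₀` and `ξ ≠ 0`,
`û_j(t,ξ) = e^{−(t−t₀)|ξ|²} û_j(t₀,ξ) − (2π)^{-3} ∫_{t₀}^t e^{−(t−t')|ξ|²} i
Σ_{l,m} (δ_{jl} − ξ_jξ_l/|ξ|²) ξ_m (û_l ⋆ û_m)(t',ξ) dt'`
(Fourier transform of `u(t) = e^{(t−t₀)Δ}u(t₀) − ∫_{t₀}^t e^{(t−t')Δ} ℙ div(u⊗u)(t')dt'`,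
where `ℙ = Id − ∇Δ⁻¹div` is the Leray projector). -/
def IsNSMildFourier (t₀ : ℝ) (u : ℝ → Rd 3 → CN 3) : Prop :=
  ∀ t : ℝ, t₀ < t → ∀ ξ : Rd 3, ξ ≠ 0 → ∀ j : Fin 3,
    u t ξ j = (Real.exp (-((t - t₀) * ‖ξ‖ ^ 2)) : ℂ) * u t₀ ξ j -
      (((2 * Real.pi) ^ (3:ℕ) : ℝ) : ℂ)⁻¹ *
        ∫ t' in Set.Ioc t₀ t,
          (Real.exp (-((t - t') * ‖ξ‖ ^ 2)) : ℂ) * Complex.I *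
            ∑ l : Fin 3, ∑ m : Fin 3,
              ((((if j = l then (1:ℝ) else 0) - ξ j * ξ l / ‖ξ‖ ^ 2 : ℝ)) : ℂ) *
                ((ξ m : ℝ) : ℂ) *
                conv2C (fun η => u t' η l) (fun η => u t' η m) ξ

/-- The Fourier-side Duhamel inequality satisfied by mild solutions of the 3D
Navier–Stokes equations, from initial time `t₀`, on `(t₀, t₀+T]`:
`|û(t,ξ)| ≤ e^{−(t−t₀)|ξ|²}|û(t₀,ξ)| + C₀ ∫_{t₀}^t e^{−(t−t')|ξ|²}|ξ| (|û(t')|⋆|û(t')|)(ξ) dt'`. -/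
def NSDuhamelIneq (C₀ t₀ T : ℝ) (u : ℝ → Rd 3 → CN 3) : Prop :=
  ∀ t ∈ Set.Ioc t₀ (t₀ + T), ∀ ξ : Rd 3,
    ENNReal.ofReal ‖u t ξ‖ ≤
      ENNReal.ofReal (Real.exp (-((t - t₀) * ‖ξ‖ ^ 2)) * ‖u t₀ ξ‖) +
        ENNReal.ofReal C₀ *
          ∫⁻ t' in Set.Ioc t₀ t,
            ENNReal.ofReal (Real.exp (-((t - t') * ‖ξ‖ ^ 2)) * ‖ξ‖) *
              conv2E (fun η => ENNReal.ofReal ‖u t' η‖)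
                (fun η => ENNReal.ofReal ‖u t' η‖) ξ

/-- The Gevrey-weighted modulus `û_{a,t₀}(t,ξ)` with initial time `t₀`:
`e^{−λ²(t−t₀)/(4(1−ε)T) + λ(t−t₀)|ξ|/√T} |û(t,ξ)|`. -/
def NSgevrey (ε lam T t₀ : ℝ) (u : ℝ → Rd 3 → CN 3) : ℝ → Rd 3 → ℝ :=
  fun t ξ =>
    Real.exp (-(lam ^ 2 * (t - t₀)) / (4 * (1 - ε) * T) + lam * (t - t₀) * ‖ξ‖ / Real.sqrt T)
      * ‖u t ξ‖

/-- Shifted Kato norm `‖v‖_{K^p_{t₀,T}} = sup_{t₀<t≤t₀+T} (t−t₀)^{1/p} ‖v(t)‖_{Ḣ^{1/2+2/p}}`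
for a scalar nonnegative Fourier-side function of time. -/
def NSkatoR (p t₀ T : ℝ) (g : ℝ → Rd 3 → ℝ) : ℝ≥0∞ :=
  ⨆ t ∈ Set.Ioc t₀ (t₀ + T), ENNReal.ofReal ((t - t₀) ^ (1 / p)) * hSobR 3 (1/2 + 2 / p) (g t)

/-- Shifted Kato norm for a vector-valued Fourier-side function of time. -/
def NSkatoC (p t₀ T : ℝ) (U : ℝ → Rd 3 → CN 3) : ℝ≥0∞ :=
  ⨆ t ∈ Set.Ioc t₀ (t₀ + T), ENNReal.ofReal ((t - t₀) ^ (1 / p)) * hSob 3 3 (1/2 + 2 / p) (U t)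

/-- The inhomogeneous `H^{1/2}(ℝ³)` norm, on the Fourier side. -/
def hInhomHalf (g : Rd 3 → CN 3) : ℝ≥0∞ :=
  (∫⁻ ξ : Rd 3, ENNReal.ofReal ((1 + ‖ξ‖ ^ 2) ^ ((1:ℝ)/2) * ‖g ξ‖ ^ 2)) ^ (1/2 : ℝ)

lemma aux_scale (f : Rd 3 → ℝ≥0∞) (hf : Measurable f) (R : ℝ) (hR : 0 < R) :
    ∫⁻ x, f x = ENNReal.ofReal (R ^ 3) * ∫⁻ x, f (R • x) := by
  have h := Measure.map_addHaar_smul (volume : Measure (Rd 3)) hR.ne'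
  have h2 : ∫⁻ x, f (R • x) = ∫⁻ x, f x ∂(Measure.map (R • ·) (volume : Measure (Rd 3))) := by
    rw [lintegral_map hf (measurable_const_smul R)]
  rw [h2, h, lintegral_smul_measure]
  have : Module.finrank ℝ (Rd 3) = 3 := by simp [Rd]
  rw [this, abs_of_pos (by positivity), smul_eq_mul, ← mul_assoc,
    ← ENNReal.ofReal_mul (by positivity), mul_inv_cancel₀ (by positivity)]
  simp

lemma aux_ball (b : ℝ) (hb : -3 < b) : ∃ A : ℝ, 0 < A ∧ ∀ R : ℝ, 0 < R →
    ∫⁻ x in Metric.ball (0 : Rd 3) R, ENNReal.ofReal (‖x‖ ^ b) ≤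
      ENNReal.ofReal (A * R ^ (3 + b)) := by
  have hfin : Module.finrank ℝ (Rd 3) = 3 := by simp [Rd]
  have h1 : IntegrableOn (fun x : Rd 3 => ‖x‖ ^ b) (Metric.ball 0 1) := by
    rw [integrableOn_fun_norm_addHaar volume (f := fun r => r ^ b), hfin]
    have h2 : IntegrableOn (fun y : ℝ => y ^ (2 + b)) (Set.Ioo 0 1) := by
      rw [intervalIntegral.integrableOn_Ioo_rpow_iff (by norm_num)]; linarith
    refine h2.congr_fun ?_ measurableSet_Ioo
    intro y hy
    simp only [smul_eq_mul]
    rw [Real.rpow_add hy.1]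
    norm_num
  set I := ∫⁻ x in Metric.ball (0 : Rd 3) 1, ENNReal.ofReal (‖x‖ ^ b) with hI
  have hIf : I ≠ ⊤ := by
    have := h1.2
    rw [hasFiniteIntegral_iff_ofReal] at this
    · exact this.ne
    · exact Eventually.of_forall fun x => by positivity
  refine ⟨I.toReal + 1, by positivity, fun R hR => ?_⟩
  have hm : Measurable fun x : Rd 3 => ENNReal.ofReal (‖x‖ ^ b) := by fun_prop
  rw [← lintegral_indicator measurableSet_ball, aux_scale _ (hm.indicator measurableSet_ball) R hR]
  have : ∀ x : Rd 3, (Metric.ball (0 : Rd 3) R).indicator (fun x => ENNReal.ofReal (‖x‖ ^ b)) (R • x)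
      = ENNReal.ofReal (R ^ b) *
        (Metric.ball (0 : Rd 3) 1).indicator (fun x => ENNReal.ofReal (‖x‖ ^ b)) x := by
    intro x
    have hiff : R • x ∈ Metric.ball (0 : Rd 3) R ↔ x ∈ Metric.ball (0 : Rd 3) 1 := by
      simp only [Metric.mem_ball, dist_zero_right, norm_smul, Real.norm_eq_abs, abs_of_pos hR]
      constructor
      · intro h; nlinarith
      · intro h; nlinarith
    by_cases hx : x ∈ Metric.ball (0 : Rd 3) 1
    · rw [Set.indicator_of_mem hx, Set.indicator_of_mem (hiff.2 hx),
        ← ENNReal.ofReal_mul (by positivity), norm_smul, Real.norm_eq_abs, abs_of_pos hR,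
        Real.mul_rpow hR.le (norm_nonneg _)]
    · rw [Set.indicator_of_notMem hx, Set.indicator_of_notMem (fun h => hx (hiff.1 h)), mul_zero]
  simp_rw [this]
  rw [lintegral_const_mul _ (hm.indicator measurableSet_ball), lintegral_indicator measurableSet_ball,
    ← hI, ← mul_assoc, ← ENNReal.ofReal_mul (by positivity)]
  have e : R ^ 3 * R ^ b = R ^ (3 + b) := by
    rw [Real.rpow_add hR]; norm_num
  rw [e, mul_comm, ENNReal.ofReal_mul (by positivity)]
  gcongr
  rw [← ENNReal.ofReal_toReal hIf]
  apply ENNReal.ofReal_le_ofReal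
  simp

lemma aux_time (a b : ℝ) (ha : 0 < a) (hb : 0 < b) : ∃ B : ℝ, 0 < B ∧ ∀ t₀ t : ℝ, t₀ < t →
    ∫⁻ t' in Set.Ioo t₀ t, ENNReal.ofReal ((t - t') ^ (b - 1) * (t' - t₀) ^ (a - 1)) ≤
      ENNReal.ofReal (B * (t - t₀) ^ (a + b - 1)) := by
  have hpos := ProbabilityTheory.beta_pos ha hb
  set β := ProbabilityTheory.beta a b with hβ
  refine ⟨β, hpos, fun t₀ t ht => ?_⟩
  set R := t - t₀ with hR
  have hR0 : 0 < R := by linarith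
  have h1 := ProbabilityTheory.lintegral_betaPDF_eq_one ha hb
  rw [ProbabilityTheory.lintegral_betaPDF] at h1
  have hm : Measurable fun t' : ℝ => ENNReal.ofReal ((t - t') ^ (b - 1) * (t' - t₀) ^ (a - 1)) := by
    fun_prop
  set F := (Set.Ioo t₀ t).indicator
    (fun t' : ℝ => ENNReal.ofReal ((t - t') ^ (b - 1) * (t' - t₀) ^ (a - 1))) with hF
  have hFm : Measurable F := hm.indicator measurableSet_Ioo
  rw [← lintegral_indicator measurableSet_Ioo, ← hF, ← lintegral_add_right_eq_self _ t₀]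
  have h2 := Measure.map_addHaar_smul (volume : Measure ℝ) hR0.ne'
  have hFm2 : Measurable fun x => F (x + t₀) := hFm.comp (measurable_add_const t₀)
  have h3 : ∫⁻ x, F (R • x + t₀) = ENNReal.ofReal (R⁻¹) * ∫⁻ x, F (x + t₀) := by
    have : ∫⁻ x, F (R • x + t₀) = ∫⁻ x, F (x + t₀) ∂(Measure.map (R • ·) (volume : Measure ℝ)) := by
      rw [lintegral_map hFm2 (measurable_const_smul R)]
    rw [this, h2, lintegral_smul_measure]
    simp [abs_of_pos hR0]
  have h4 : ∫⁻ x, F (x + t₀) = ENNReal.ofReal R * ∫⁻ x, F (R • x + t₀) := by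
    rw [h3, ← mul_assoc, ← ENNReal.ofReal_mul hR0.le, mul_inv_cancel₀ hR0.ne']; simp
  have h5 : ∀ x, F (R • x + t₀) = ENNReal.ofReal (β * R ^ (a + b - 2)) *
      (Set.Ioo (0:ℝ) 1).indicator
        (fun x => ENNReal.ofReal (1 / β * x ^ (a - 1) * (1 - x) ^ (b - 1))) x := by
    intro x
    have hiff : R • x + t₀ ∈ Set.Ioo t₀ t ↔ x ∈ Set.Ioo (0:ℝ) 1 := by
      simp only [Set.mem_Ioo, smul_eq_mul]
      constructor
      · rintro ⟨h, h'⟩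
        constructor
        · by_contra hx; nlinarith
        · by_contra hx; nlinarith
      · rintro ⟨h, h'⟩
        constructor
        · nlinarith
        · nlinarith
    by_cases hx : x ∈ Set.Ioo (0:ℝ) 1
    · rw [Set.indicator_of_mem hx, hF, Set.indicator_of_mem (hiff.2 hx),
        ← ENNReal.ofReal_mul (by positivity)]
      congr 1
      have e1 : t - (R • x + t₀) = R * (1 - x) := by rw [smul_eq_mul, hR]; ring
      have e2 : R • x + t₀ - t₀ = R * x := by rw [smul_eq_mul]; ring
      rw [e1, e2, Real.mul_rpow hR0.le (by linarith [hx.2]), Real.mul_rpow hR0.le hx.1.le,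
        show a + b - 2 = (a - 1) + (b - 1) by ring, Real.rpow_add hR0]
      field_simp
    · rw [Set.indicator_of_notMem hx, hF, Set.indicator_of_notMem (fun h => hx (hiff.1 h)), mul_zero]
  rw [h4]
  simp_rw [h5]
  rw [lintegral_const_mul' _ _ ENNReal.ofReal_ne_top, lintegral_indicator measurableSet_Ioo, h1,
    mul_one, ← ENNReal.ofReal_mul hR0.le]
  apply ENNReal.ofReal_le_ofReal
  rw [show a + b - 1 = (a + b - 2) + 1 by ring, Real.rpow_add hR0, Real.rpow_one]
  apply le_of_eq; ring

lemma aux_cs {α : Type*} [MeasurableSpace α] (μ : Measure α) (f g : α → ℝ≥0∞)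
    (hf : AEMeasurable f μ) (hg : AEMeasurable g μ) :
    (∫⁻ a, f a * g a ∂μ) ^ 2 ≤ (∫⁻ a, f a ^ 2 ∂μ) * ∫⁻ a, g a ^ 2 ∂μ := by
  have h := ENNReal.lintegral_mul_le_Lp_mul_Lq μ (Real.HolderConjugate.two_two) hf hg
  simp only [Pi.mul_apply, ENNReal.rpow_two] at h
  calc _ ≤ _ := pow_le_pow_left' h 2
    _ = _ := by
      rw [mul_pow, ← ENNReal.rpow_two, ← ENNReal.rpow_two, ← ENNReal.rpow_mul, ← ENNReal.rpow_mul]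
      norm_num

lemma aux_kernel_pt (s R x y : ℝ) (hs : 0 < s) (hR : 0 < R) (hx : 0 ≤ x) (hxR : x ≤ R)
    (hy1 : R - x ≤ y) (hy2 : y ≤ R + x) :
    x ^ (-(2 * s)) * y ^ (4 * s - 3) ≤
      2 ^ (2 * s) * R ^ (-(2 * s)) * y ^ (4 * s - 3) +
      (2 ^ (4 * s - 3) + 2 ^ (-(4 * s - 3))) * R ^ (4 * s - 3) * x ^ (-(2 * s)) := by
  have hy0 : 0 ≤ y := by linarith
  by_cases h : R / 2 ≤ x
  · have h1 : x ^ (-(2 * s)) ≤ (R / 2) ^ (-(2 * s)) :=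
      Real.rpow_le_rpow_of_nonpos (by positivity) h (by linarith)
    have h2 : (R / 2) ^ (-(2 * s)) = 2 ^ (2 * s) * R ^ (-(2 * s)) := by
      rw [Real.div_rpow hR.le (by norm_num), Real.rpow_neg (x := 2) (by norm_num)]
      field_simp
    rw [h2] at h1
    have : 0 ≤ (2 ^ (4 * s - 3) + 2 ^ (-(4 * s - 3))) * R ^ (4 * s - 3) * x ^ (-(2 * s)) := by
      positivity
    have h3 := mul_le_mul_of_nonneg_right h1 (Real.rpow_nonneg hy0 (4 * s - 3))
    linarith
  · push Not at h
    have hyp : R / 2 ≤ y := by linarith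
    have hyp2 : y ≤ 2 * R := by linarith
    have h1 : y ^ (4 * s - 3) ≤ (2 ^ (4 * s - 3) + 2 ^ (-(4 * s - 3))) * R ^ (4 * s - 3) := by
      rcases le_total 0 (4 * s - 3) with hb | hb
      · have := Real.rpow_le_rpow hy0 hyp2 hb
        rw [Real.mul_rpow (by norm_num) hR.le] at this
        have : 0 ≤ (2:ℝ) ^ (-(4 * s - 3)) * R ^ (4 * s - 3) := by positivity
        linarith
      · have := Real.rpow_le_rpow_of_nonpos (by positivity) hyp hb
        rw [Real.div_rpow hR.le (by norm_num), div_eq_mul_inv, ← Real.rpow_neg (by norm_num)] at this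
        have : 0 ≤ (2:ℝ) ^ ((4 * s - 3)) * R ^ (4 * s - 3) := by positivity
        linarith
    have h3 := mul_le_mul_of_nonneg_right h1 (Real.rpow_nonneg hx (-(2 * s)))
    have : 0 ≤ 2 ^ (2 * s) * R ^ (-(2 * s)) * y ^ (4 * s - 3) := by positivity
    linarith

lemma aux_kernel (s : ℝ) (hs : 0 < s) (hs2 : s < 3 / 2) : ∃ A : ℝ, 0 < A ∧ ∀ η : Rd 3, η ≠ 0 →
    ∫⁻ ζ : Rd 3, {ζ : Rd 3 | ‖ζ‖ ≤ ‖η‖}.indicator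
      (fun ζ => ENNReal.ofReal (‖ζ‖ ^ (-(2 * s))) * ENNReal.ofReal (‖η + ζ‖ ^ (4 * s - 3))) ζ ≤
      ENNReal.ofReal (A * ‖η‖ ^ (2 * s)) := by
  obtain ⟨A1, hA1, h1⟩ := aux_ball (4 * s - 3) (by linarith)
  obtain ⟨A2, hA2, h2⟩ := aux_ball (-(2 * s)) (by linarith)
  set c1 : ℝ := 2 ^ (2 * s) with hc1
  set c2 : ℝ := (2 ^ (4 * s - 3) + 2 ^ (-(4 * s - 3))) with hc2
  have hc1p : 0 < c1 := by positivity
  have hc2p : 0 < c2 := by positivity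
  refine ⟨c1 * (A1 * 3 ^ (4 * s)) + c2 * (A2 * 2 ^ (3 - 2 * s)), by positivity, fun η hη => ?_⟩
  set R := ‖η‖ with hRdef
  have hR : 0 < R := norm_pos_iff.2 hη
  set I1 := (Metric.ball (0 : Rd 3) (3 * R)).indicator (fun x => ENNReal.ofReal (‖x‖ ^ (4 * s - 3)))
    with hI1
  set I2 := (Metric.ball (0 : Rd 3) (2 * R)).indicator (fun x => ENNReal.ofReal (‖x‖ ^ (-(2 * s))))
    with hI2
  have hI1m : Measurable I1 := Measurable.indicator (by fun_prop) measurableSet_ball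
  have hI2m : Measurable I2 := Measurable.indicator (by fun_prop) measurableSet_ball
  have hpt : ∀ ζ : Rd 3, {ζ : Rd 3 | ‖ζ‖ ≤ R}.indicator
      (fun ζ => ENNReal.ofReal (‖ζ‖ ^ (-(2 * s))) * ENNReal.ofReal (‖η + ζ‖ ^ (4 * s - 3))) ζ ≤
      ENNReal.ofReal (c1 * R ^ (-(2 * s))) * I1 (η + ζ) +
      ENNReal.ofReal (c2 * R ^ (4 * s - 3)) * I2 ζ := by
    intro ζ
    by_cases hζ : ‖ζ‖ ≤ R
    · rw [Set.indicator_of_mem (by exact hζ), hI1, hI2, Set.indicator_of_mem, Set.indicator_of_mem,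
        ← ENNReal.ofReal_mul (by positivity), ← ENNReal.ofReal_mul (by positivity),
        ← ENNReal.ofReal_mul (by positivity), ← ENNReal.ofReal_add (by positivity) (by positivity)]
      · apply ENNReal.ofReal_le_ofReal
        apply aux_kernel_pt s R ‖ζ‖ ‖η + ζ‖ hs hR (norm_nonneg _) hζ
        · have := norm_sub_norm_le η (-ζ)
          simpa using this
        · exact norm_add_le _ _
      · simp only [Metric.mem_ball, dist_zero_right]; linarith
      · simp only [Metric.mem_ball, dist_zero_right]
        have := norm_add_le η ζ
        linarith
    · rw [Set.indicator_of_notMem (by exact hζ)]; exact zero_le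
  refine (lintegral_mono hpt).trans ?_
  rw [lintegral_add_right _ (hI2m.const_mul _), lintegral_const_mul' _ _ ENNReal.ofReal_ne_top,
    lintegral_const_mul' _ _ ENNReal.ofReal_ne_top, lintegral_add_left_eq_self I1 η, hI1, hI2,
    lintegral_indicator measurableSet_ball, lintegral_indicator measurableSet_ball]
  have k1 := h1 (3 * R) (by positivity)
  have k2 := h2 (2 * R) (by positivity)
  calc _ ≤ ENNReal.ofReal (c1 * R ^ (-(2 * s))) * ENNReal.ofReal (A1 * (3 * R) ^ (3 + (4 * s - 3)))
        + ENNReal.ofReal (c2 * R ^ (4 * s - 3)) * ENNReal.ofReal (A2 * (2 * R) ^ (3 + -(2 * s))) := by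
        gcongr
    _ = _ := by
      rw [← ENNReal.ofReal_mul (by positivity),
        ← ENNReal.ofReal_mul (by positivity), ← ENNReal.ofReal_add (by positivity) (by positivity)]
      congr 1
      rw [Real.mul_rpow (by norm_num) hR.le, Real.mul_rpow (by norm_num) hR.le]
      rw [show 3 + (4 * s - 3) = 4 * s by ring, show 3 + -(2 * s) = 3 - 2 * s by ring]
      have e1 : R ^ (-(2 * s)) * R ^ (4 * s) = R ^ (2 * s) := by
        rw [← Real.rpow_add hR]; ring_nf
      have e2 : R ^ (4 * s - 3) * R ^ (3 - 2 * s) = R ^ (2 * s) := by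
        rw [← Real.rpow_add hR]; ring_nf
      calc _ = c1 * (A1 * 3 ^ (4 * s)) * (R ^ (-(2 * s)) * R ^ (4 * s)) +
            c2 * (A2 * 2 ^ (3 - 2 * s)) * (R ^ (4 * s - 3) * R ^ (3 - 2 * s)) := by ring
        _ = _ := by rw [e1, e2]; ring

/-- Fourier-side squared norm. -/
def auxN (s : ℝ) (f : Rd 3 → ℝ≥0∞) : ℝ≥0∞ := ∫⁻ ξ : Rd 3, ENNReal.ofReal (‖ξ‖ ^ (2 * s)) * f ξ ^ 2

lemma aux_conv_le (f : Rd 3 → ℝ≥0∞) (hf : Measurable f) (ξ : Rd 3) :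
    conv2E f f ξ ≤ 2 * ∫⁻ η : Rd 3, {η : Rd 3 | ‖ξ - η‖ ≤ ‖η‖}.indicator
      (fun η => f η * f (ξ - η)) η := by
  set G := {η : Rd 3 | ‖ξ - η‖ ≤ ‖η‖}.indicator (fun η => f η * f (ξ - η)) with hG
  have hset : MeasurableSet {η : Rd 3 | ‖ξ - η‖ ≤ ‖η‖} :=
    measurableSet_le (by fun_prop) (by fun_prop)
  have hGm : Measurable G := by
    refine Measurable.indicator ?_ hset
    exact hf.mul (hf.comp (measurable_const.sub measurable_id))
  have h1 : ∫⁻ η, G (ξ - η) = ∫⁻ η, G η := lintegral_sub_left_eq_self G ξ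
  rw [two_mul]
  nth_rewrite 2 [← h1]
  rw [← lintegral_add_left hGm]
  apply lintegral_mono
  intro η
  rcases le_total ‖ξ - η‖ ‖η‖ with h | h
  · have : G η = f η * f (ξ - η) := Set.indicator_of_mem (by exact h) _
    simp only [this]
    exact le_self_add
  · have : G (ξ - η) = f η * f (ξ - η) := by
      rw [hG, Set.indicator_of_mem]
      · rw [sub_sub_cancel, mul_comm]
      · simpa using h
    simp only [this]
    exact le_add_self

set_option maxHeartbeats 1000000 in
lemma aux_bilin (s : ℝ) (hs : 0 < s) (hs2 : s < 3 / 2) : ∃ A : ℝ, 0 < A ∧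
    ∀ f : Rd 3 → ℝ≥0∞, Measurable f →
    ∫⁻ ξ : Rd 3, ENNReal.ofReal (‖ξ‖ ^ (4 * s - 3)) * conv2E f f ξ ^ 2 ≤
      ENNReal.ofReal A * auxN s f ^ 2 := by
  obtain ⟨A, hA, hK⟩ := aux_kernel s hs hs2
  refine ⟨4 * A, by positivity, fun f hf => ?_⟩
  set ind : Rd 3 → Rd 3 → ℝ≥0∞ := fun ξ η => {η : Rd 3 | ‖ξ - η‖ ≤ ‖η‖}.indicator 1 η with hind
  have hindm : Measurable (Function.uncurry ind) := by
    have : Function.uncurry ind = {q : Rd 3 × Rd 3 | ‖q.1 - q.2‖ ≤ ‖q.2‖}.indicator 1 := by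
      ext q
      simp [Function.uncurry, hind, Set.indicator]
    rw [this]
    exact Measurable.indicator measurable_one (measurableSet_le (by fun_prop) (by fun_prop))
  have hindx : ∀ ξ : Rd 3, Measurable (ind ξ) := fun ξ =>
    Measurable.indicator measurable_one (measurableSet_le (by fun_prop) (by fun_prop))
  have hne : ∀ ξ : Rd 3, ∀ᵐ η : Rd 3, ξ - η ≠ 0 := by
    intro ξ
    have : ∀ᵐ η : Rd 3, η ≠ ξ := by
      rw [ae_iff]; simp
    filter_upwards [this] with η h h2
    exact h (sub_eq_zero.1 h2).symm
  have hcs : ∀ ξ : Rd 3, conv2E f f ξ ^ 2 ≤ 4 * (auxN s f *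
      ∫⁻ η : Rd 3, ENNReal.ofReal (‖ξ - η‖ ^ (-(2 * s))) * f η ^ 2 * ind ξ η) := by
    intro ξ
    have hm1 : Measurable fun η : Rd 3 => ENNReal.ofReal (‖ξ - η‖ ^ s) * f (ξ - η) := by
      have := hf.comp (measurable_const.sub measurable_id : Measurable fun η : Rd 3 => ξ - η)
      simp only [Function.comp_def] at this
      fun_prop
    have hm2 : Measurable fun η : Rd 3 => ENNReal.ofReal (‖ξ - η‖ ^ (-s)) * f η * ind ξ η := by
      have : Measurable (ind ξ) := hindx ξ
      fun_prop
    have h1 := aux_cs volume _ _ hm1.aemeasurable hm2.aemeasurable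
    have h2 : ∫⁻ η : Rd 3, (ENNReal.ofReal (‖ξ - η‖ ^ s) * f (ξ - η)) ^ 2 = auxN s f := by
      have := lintegral_sub_left_eq_self (μ := volume)
        (fun x : Rd 3 => (ENNReal.ofReal (‖x‖ ^ s) * f x) ^ 2) ξ
      rw [this, auxN]
      congr with x
      rw [mul_pow, ← ENNReal.ofReal_pow (by positivity), ← Real.rpow_natCast, ← Real.rpow_mul (norm_nonneg _)]
      norm_num [mul_comm]
    have h3 : ∫⁻ η : Rd 3, (ENNReal.ofReal (‖ξ - η‖ ^ (-s)) * f η * ind ξ η) ^ 2 =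
        ∫⁻ η : Rd 3, ENNReal.ofReal (‖ξ - η‖ ^ (-(2 * s))) * f η ^ 2 * ind ξ η := by
      congr with η
      rw [mul_pow, mul_pow, ← ENNReal.ofReal_pow (by positivity), ← Real.rpow_natCast,
        ← Real.rpow_mul (norm_nonneg _)]
      congr 2
      · norm_num [mul_comm]
      · by_cases h : ‖ξ - η‖ ≤ ‖η‖ <;> simp [hind, Set.indicator, h]
    have h4 : ∫⁻ η : Rd 3, {η : Rd 3 | ‖ξ - η‖ ≤ ‖η‖}.indicator (fun η => f η * f (ξ - η)) η =
        ∫⁻ η : Rd 3, (ENNReal.ofReal (‖ξ - η‖ ^ s) * f (ξ - η)) *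
          (ENNReal.ofReal (‖ξ - η‖ ^ (-s)) * f η * ind ξ η) := by
      apply lintegral_congr_ae
      filter_upwards [hne ξ] with η hη
      have hpos : 0 < ‖ξ - η‖ := norm_pos_iff.2 hη
      have e : ENNReal.ofReal (‖ξ - η‖ ^ s) * ENNReal.ofReal (‖ξ - η‖ ^ (-s)) = 1 := by
        rw [← ENNReal.ofReal_mul (by positivity), ← Real.rpow_add hpos]; simp
      calc _ = 1 * (f η * f (ξ - η)) * ind ξ η := by
            by_cases h : ‖ξ - η‖ ≤ ‖η‖ <;> simp [hind, Set.indicator, h]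
        _ = _ := by rw [← e]; ring
    calc _ ≤ _ := pow_le_pow_left' (aux_conv_le f hf ξ) 2
      _ = 4 * (∫⁻ η : Rd 3, {η : Rd 3 | ‖ξ - η‖ ≤ ‖η‖}.indicator (fun η => f η * f (ξ - η)) η) ^ 2 := by
        rw [mul_pow]; norm_num
      _ ≤ _ := by
        rw [h4, ← h2, ← h3]
        gcongr
  have hmeas : Measurable (Function.uncurry fun (ξ η : Rd 3) => ENNReal.ofReal (‖ξ‖ ^ (4 * s - 3)) *
      (ENNReal.ofReal (‖ξ - η‖ ^ (-(2 * s))) * f η ^ 2 * ind ξ η)) := by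
    have h2 : Measurable fun q : Rd 3 × Rd 3 => f q.2 := hf.comp measurable_snd
    have h3 : Measurable fun q : Rd 3 × Rd 3 => ind q.1 q.2 := hindm
    simp only [Function.uncurry_def]
    fun_prop
  have hmeas1 : ∀ ξ, Measurable fun (η : Rd 3) => 
      (ENNReal.ofReal (‖ξ - η‖ ^ (-(2 * s))) * f η ^ 2 * ind ξ η) := by
    intro ξ
    have : Measurable (ind ξ) := hindx ξ
    fun_prop
  have hmeas2 : Measurable fun ξ : Rd 3 => ∫⁻ η : Rd 3, ENNReal.ofReal (‖ξ‖ ^ (4 * s - 3)) *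
      (ENNReal.ofReal (‖ξ - η‖ ^ (-(2 * s))) * f η ^ 2 * ind ξ η) := hmeas.lintegral_prod_right'
  have step : ∫⁻ ξ : Rd 3, ∫⁻ η : Rd 3, ENNReal.ofReal (‖ξ‖ ^ (4 * s - 3)) *
      (ENNReal.ofReal (‖ξ - η‖ ^ (-(2 * s))) * f η ^ 2 * ind ξ η) ≤ ENNReal.ofReal A * auxN s f := by
    rw [lintegral_lintegral_swap hmeas.aemeasurable, auxN,
      ← lintegral_const_mul' _ _ ENNReal.ofReal_ne_top]
    apply lintegral_mono_ae
    have h0 : ∀ᵐ η : Rd 3, η ≠ 0 := by rw [ae_iff]; simp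
    filter_upwards [h0] with η hη
    have hk := hK η hη
    calc ∫⁻ ξ : Rd 3, ENNReal.ofReal (‖ξ‖ ^ (4 * s - 3)) *
          (ENNReal.ofReal (‖ξ - η‖ ^ (-(2 * s))) * f η ^ 2 * ind ξ η)
        = ∫⁻ ζ : Rd 3, ENNReal.ofReal (‖η + ζ‖ ^ (4 * s - 3)) *
          (ENNReal.ofReal (‖η + ζ - η‖ ^ (-(2 * s))) * f η ^ 2 * ind (η + ζ) η) :=
          (lintegral_add_left_eq_self (fun ξ => ENNReal.ofReal (‖ξ‖ ^ (4 * s - 3)) *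
          (ENNReal.ofReal (‖ξ - η‖ ^ (-(2 * s))) * f η ^ 2 * ind ξ η)) η).symm
      _ = ∫⁻ ζ : Rd 3, f η ^ 2 * {ζ : Rd 3 | ‖ζ‖ ≤ ‖η‖}.indicator
            (fun ζ => ENNReal.ofReal (‖ζ‖ ^ (-(2 * s))) * ENNReal.ofReal (‖η + ζ‖ ^ (4 * s - 3))) ζ := by
          congr with ζ
          by_cases h : ‖ζ‖ ≤ ‖η‖
          · simp [hind, Set.indicator, h]; ring
          · simp [hind, Set.indicator, h]
      _ ≤ f η ^ 2 * ENNReal.ofReal (A * ‖η‖ ^ (2 * s)) := by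
          rw [lintegral_const_mul]
          · gcongr
          · refine Measurable.indicator (by fun_prop) (measurableSet_le (by fun_prop) (by fun_prop))
      _ = _ := by rw [ENNReal.ofReal_mul hA.le]; ring
  calc _ ≤ ∫⁻ ξ : Rd 3, 4 * auxN s f * ∫⁻ η : Rd 3, ENNReal.ofReal (‖ξ‖ ^ (4 * s - 3)) *
      (ENNReal.ofReal (‖ξ - η‖ ^ (-(2 * s))) * f η ^ 2 * ind ξ η) := by
        apply lintegral_mono
        intro ξ
        simp only
        rw [lintegral_const_mul' _ _ ENNReal.ofReal_ne_top]
        calc _ ≤ ENNReal.ofReal (‖ξ‖ ^ (4 * s - 3)) * _ := mul_le_mul_right (hcs ξ) _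
          _ = _ := by ring
    _ = 4 * auxN s f * _ := lintegral_const_mul _ hmeas2
    _ ≤ 4 * auxN s f * (ENNReal.ofReal A * auxN s f) := by gcongr
    _ = _ := by
      rw [ENNReal.ofReal_mul (by norm_num)]
      norm_num
      ring

lemma aux_wcs {α : Type*} [MeasurableSpace α] (μ : Measure α) (w : α → ℝ) (h : α → ℝ≥0∞)
    (hw : Measurable w) (hpos : ∀ᵐ a ∂μ, 0 < w a) (hh : Measurable h) :
    (∫⁻ a, h a ∂μ) ^ 2 ≤ (∫⁻ a, ENNReal.ofReal (w a) ∂μ) *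
      ∫⁻ a, ENNReal.ofReal ((w a)⁻¹) * h a ^ 2 ∂μ := by
  have h1 := aux_cs μ (fun a => ENNReal.ofReal (√(w a))) (fun a => ENNReal.ofReal ((√(w a))⁻¹) * h a)
    (by fun_prop) (by fun_prop)
  have e1 : ∫⁻ a, ENNReal.ofReal (√(w a)) * (ENNReal.ofReal ((√(w a))⁻¹) * h a) ∂μ = ∫⁻ a, h a ∂μ := by
    apply lintegral_congr_ae
    filter_upwards [hpos] with a ha
    have : 0 < √(w a) := Real.sqrt_pos.2 ha
    rw [← mul_assoc, ← ENNReal.ofReal_mul this.le, mul_inv_cancel₀ this.ne']; simp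
  have e2 : ∫⁻ a, ENNReal.ofReal (√(w a)) ^ 2 ∂μ = ∫⁻ a, ENNReal.ofReal (w a) ∂μ := by
    apply lintegral_congr_ae
    filter_upwards [hpos] with a ha
    rw [← ENNReal.ofReal_pow (by positivity), Real.sq_sqrt ha.le]
  have e3 : ∫⁻ a, (ENNReal.ofReal ((√(w a))⁻¹) * h a) ^ 2 ∂μ =
      ∫⁻ a, ENNReal.ofReal ((w a)⁻¹) * h a ^ 2 ∂μ := by
    apply lintegral_congr_ae
    filter_upwards [hpos] with a ha
    rw [mul_pow, ← ENNReal.ofReal_pow (by positivity), inv_pow, Real.sq_sqrt ha.le]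
  rwa [e1, e2, e3] at h1

lemma aux_heat (ε a y : ℝ) (hε : 0 < ε) (hε1 : ε < 1) (ha : 0 ≤ a) (ha1 : a ≤ 1) (hy : 0 ≤ y) :
    y ^ a * Real.exp (-(ε * y)) ≤ ε⁻¹ := by
  have h1 : y ^ a ≤ 1 + y := by
    rcases le_total y 1 with h | h
    · have := Real.rpow_le_one hy h ha
      linarith
    · have := Real.rpow_le_rpow_of_exponent_le h ha1
      rw [Real.rpow_one] at this
      linarith
  have h2 : 1 + y ≤ ε⁻¹ * Real.exp (ε * y) := by
    have := Real.add_one_le_exp (ε * y)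
    rw [inv_mul_eq_div, le_div_iff₀ hε]
    nlinarith
  rw [Real.exp_neg, ← div_eq_mul_inv, div_le_iff₀ (Real.exp_pos _)]
  linarith

lemma aux_heat2 (ε p σ r : ℝ) (hε : 0 < ε) (hε1 : ε < 1) (hp : 2 < p) (hσ : 0 < σ) (hr : 0 ≤ r) :
    r ^ (2 * (1 / 2 + 2 / p)) * (Real.exp (-(ε * σ * r ^ 2)) * r) ^ 2 ≤
      (ε⁻¹ * σ ^ (1 / p - 1)) ^ 2 * r ^ (4 * (1 / 2 + 2 / p) - 3) := by
  rcases hr.eq_or_lt with h | h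
  · rw [← h]
    simp only [mul_zero, ne_eq, OfNat.ofNat_ne_zero, not_false_eq_true, zero_pow]
    exact mul_nonneg (by positivity) (Real.rpow_nonneg le_rfl _)
  · have hip : 0 < 1 / p := by positivity
    have hip1 : 1 / p < 1 := by rw [div_lt_one (by linarith)]; linarith
    have h1 := aux_heat ε (1 - 1 / p) (σ * r ^ 2) hε hε1 (by linarith) (by linarith) (by positivity)
    rw [Real.mul_rpow hσ.le (by positivity)] at h1
    have e1 : (r ^ 2) ^ (1 - 1 / p) = r ^ (2 - 2 / p) := by
      rw [← Real.rpow_natCast, ← Real.rpow_mul h.le]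
      congr 1; push_cast; ring
    have e2 : σ ^ (1 / p - 1) * σ ^ (1 - 1 / p) = 1 := by
      rw [← Real.rpow_add hσ]; simp
    rw [e1] at h1
    have h2 : r ^ (2 - 2 / p) * Real.exp (-(ε * σ * r ^ 2)) ≤ ε⁻¹ * σ ^ (1 / p - 1) := by
      calc _ = (σ ^ (1 / p - 1) * σ ^ (1 - 1 / p)) * (r ^ (2 - 2 / p) * Real.exp (-(ε * σ * r ^ 2))) := by
            rw [e2, one_mul]
        _ = σ ^ (1 / p - 1) * (σ ^ (1 - 1 / p) * r ^ (2 - 2 / p) * Real.exp (-(ε * (σ * r ^ 2)))) := by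
            rw [← mul_assoc ε]; ring
        _ ≤ σ ^ (1 / p - 1) * ε⁻¹ := by gcongr
        _ = _ := mul_comm _ _
    have h3 : r ^ (2 * (1 / 2 + 2 / p)) * r ^ 2 = (r ^ (2 - 2 / p)) ^ 2 * r ^ (4 * (1 / 2 + 2 / p) - 3) := by
      rw [← Real.rpow_natCast, ← Real.rpow_natCast, ← Real.rpow_mul h.le, ← Real.rpow_add h,
        ← Real.rpow_add h]
      congr 1; push_cast; ring
    calc _ = (r ^ (2 * (1 / 2 + 2 / p)) * r ^ 2) * Real.exp (-(ε * σ * r ^ 2)) ^ 2 := by ring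
      _ = (r ^ (2 - 2 / p) * Real.exp (-(ε * σ * r ^ 2))) ^ 2 * r ^ (4 * (1 / 2 + 2 / p) - 3) := by
        rw [h3]; ring
      _ ≤ _ := by gcongr

lemma aux_mink (s t₀ t : ℝ) (w : ℝ → ℝ) (H : ℝ → Rd 3 → ℝ≥0∞) (M : ℝ≥0∞) (hwm : Measurable w)
    (hwpos : ∀ t' ∈ Set.Ioo t₀ t, 0 < w t') (hHm : Measurable fun q : ℝ × Rd 3 => H q.1 q.2)
    (hinner : ∀ t' ∈ Set.Ioo t₀ t, ENNReal.ofReal ((w t')⁻¹) *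
      ∫⁻ ξ : Rd 3, ENNReal.ofReal (‖ξ‖ ^ (2 * s)) * H t' ξ ^ 2 ≤ M * ENNReal.ofReal (w t')) :
    auxN s (fun ξ => ∫⁻ t' in Set.Ioo t₀ t, H t' ξ) ≤
      M * (∫⁻ t' in Set.Ioo t₀ t, ENNReal.ofReal (w t')) ^ 2 := by
  have hHm1 : ∀ ξ, Measurable fun t' => H t' ξ := fun ξ => by
    have h1 : Measurable fun t' : ℝ => (t', ξ) := by fun_prop
    exact hHm.comp h1
  have hJm : Measurable (Function.uncurry fun (ξ : Rd 3) (t' : ℝ) =>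
      ENNReal.ofReal (‖ξ‖ ^ (2 * s)) * (ENNReal.ofReal ((w t')⁻¹) * H t' ξ ^ 2)) := by
    have : Measurable fun q : Rd 3 × ℝ => H q.2 q.1 := hHm.comp measurable_swap
    simp only [Function.uncurry_def]
    fun_prop
  have hJm2 : Measurable fun (ξ : Rd 3) => ∫⁻ t' in Set.Ioo t₀ t,
      ENNReal.ofReal (‖ξ‖ ^ (2 * s)) * (ENNReal.ofReal ((w t')⁻¹) * H t' ξ ^ 2) :=
    hJm.lintegral_prod_right'
  calc auxN s (fun ξ => ∫⁻ t' in Set.Ioo t₀ t, H t' ξ)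
      ≤ ∫⁻ ξ : Rd 3, (∫⁻ t' in Set.Ioo t₀ t, ENNReal.ofReal (w t')) * ∫⁻ t' in Set.Ioo t₀ t,
        ENNReal.ofReal (‖ξ‖ ^ (2 * s)) * (ENNReal.ofReal ((w t')⁻¹) * H t' ξ ^ 2) := by
        apply lintegral_mono
        intro ξ
        simp only
        rw [lintegral_const_mul' _ _ ENNReal.ofReal_ne_top, mul_left_comm]
        refine mul_le_mul_right ?_ _
        have hae : ∀ᵐ a ∂(volume.restrict (Set.Ioo t₀ t)), 0 < w a :=
          (ae_restrict_iff' measurableSet_Ioo).2 (Eventually.of_forall hwpos)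
        have h9 := aux_wcs (volume.restrict (Set.Ioo t₀ t)) w (fun t' => H t' ξ) hwm hae (hHm1 ξ)
        exact h9
    _ = (∫⁻ t' in Set.Ioo t₀ t, ENNReal.ofReal (w t')) * ∫⁻ t' in Set.Ioo t₀ t, ∫⁻ ξ : Rd 3,
        ENNReal.ofReal (‖ξ‖ ^ (2 * s)) * (ENNReal.ofReal ((w t')⁻¹) * H t' ξ ^ 2) := by
        rw [lintegral_const_mul _ hJm2, lintegral_lintegral_swap hJm.aemeasurable]
    _ ≤ (∫⁻ t' in Set.Ioo t₀ t, ENNReal.ofReal (w t')) * ∫⁻ t' in Set.Ioo t₀ t, M * ENNReal.ofReal (w t') := by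
        refine mul_le_mul_right ?_ _
        refine setLIntegral_mono_ae' measurableSet_Ioo (Eventually.of_forall ?_)
        intro t' h
        refine le_trans (le_of_eq ?_) (hinner t' h)
        rw [← lintegral_const_mul' _ _ ENNReal.ofReal_ne_top]
        congr with ξ
        ring
    _ = M * (∫⁻ t' in Set.Ioo t₀ t, ENNReal.ofReal (w t')) ^ 2 := by
        rw [lintegral_const_mul _ (by fun_prop)]; ring

lemma aux_H_meas (ε t : ℝ) (F : ℝ → Rd 3 → ℝ≥0∞) (hF : Measurable (Function.uncurry F)) :
    Measurable fun q : ℝ × Rd 3 =>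
      ENNReal.ofReal (Real.exp (-(ε * (t - q.1) * ‖q.2‖ ^ 2)) * ‖q.2‖) *
        conv2E (F q.1) (F q.1) q.2 := by
  have hcm : Measurable fun q : ℝ × Rd 3 => conv2E (F q.1) (F q.1) q.2 := by
    have : Measurable fun q : (ℝ × Rd 3) × Rd 3 => F q.1.1 q.2 * F q.1.1 (q.1.2 - q.2) := by
      apply Measurable.mul
      · exact hF.comp ((measurable_fst.comp measurable_fst).prodMk measurable_snd)
      · exact hF.comp ((measurable_fst.comp measurable_fst).prodMk
          ((measurable_snd.comp measurable_fst).sub measurable_snd))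
    exact this.lintegral_prod_right'
  refine Measurable.mul ?_ hcm
  have : Measurable fun q : ℝ × Rd 3 => Real.exp (-(ε * (t - q.1) * ‖q.2‖ ^ 2)) * ‖q.2‖ := by
    fun_prop
  exact this.ennreal_ofReal

lemma aux_G_meas (ε t₀ t : ℝ) (F : ℝ → Rd 3 → ℝ≥0∞) (hF : Measurable (Function.uncurry F)) :
    Measurable fun ξ : Rd 3 => ∫⁻ t' in Set.Ioo t₀ t,
      ENNReal.ofReal (Real.exp (-(ε * (t - t') * ‖ξ‖ ^ 2)) * ‖ξ‖) * conv2E (F t') (F t') ξ :=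
  Measurable.lintegral_prod_left' (μ := volume.restrict (Set.Ioo t₀ t)) (aux_H_meas ε t F hF)

set_option maxHeartbeats 1000000 in
lemma aux_duh (ε p : ℝ) (hε : 0 < ε) (hε1 : ε < 1) (hp : 2 < p) : ∃ D : ℝ, 0 < D ∧
    ∀ (t₀ t : ℝ) (F : ℝ → Rd 3 → ℝ≥0∞) (K : ℝ≥0∞), t₀ < t → Measurable (Function.uncurry F) →
    (∀ t' ∈ Set.Ioo t₀ t, auxN (1 / 2 + 2 / p) (F t') ≤
      (ENNReal.ofReal ((t' - t₀) ^ (-(1 / p))) * K) ^ 2) →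
    auxN (1 / 2 + 2 / p) (fun ξ => ∫⁻ t' in Set.Ioo t₀ t,
      ENNReal.ofReal (Real.exp (-(ε * (t - t') * ‖ξ‖ ^ 2)) * ‖ξ‖) * conv2E (F t') (F t') ξ) ≤
    (ENNReal.ofReal (D * (t - t₀) ^ (-(1 / p))) * K ^ 2) ^ 2 := by
  have hip : 0 < 1 / p := by positivity
  have hip2 : 2 / p < 1 := by rw [div_lt_one (by linarith)]; linarith
  have hip3 : 0 < 2 / p := by positivity
  set s := 1 / 2 + 2 / p with hs
  obtain ⟨A, hA, hbil⟩ := aux_bilin s (by linarith) (by linarith)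
  obtain ⟨B, hB, htime⟩ := aux_time (1 - 2 / p) (1 / p) (by linarith) hip
  refine ⟨ε⁻¹ * √A * B, by positivity, fun t₀ t F K ht hF hN => ?_⟩
  set w : ℝ → ℝ := fun t' => (t - t') ^ (1 / p - 1) * (t' - t₀) ^ (1 - 2 / p - 1) with hw
  have hwm : Measurable w := by fun_prop
  have hwpos : ∀ t' ∈ Set.Ioo t₀ t, 0 < w t' := by
    intro t' h
    have h1 : 0 < t - t' := by linarith [h.2]
    have h2 : 0 < t' - t₀ := by linarith [h.1]
    positivity
  set H : ℝ → Rd 3 → ℝ≥0∞ := fun t' ξ =>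
    ENNReal.ofReal (Real.exp (-(ε * (t - t') * ‖ξ‖ ^ 2)) * ‖ξ‖) * conv2E (F t') (F t') ξ with hH
  have hHm : Measurable fun q : ℝ × Rd 3 => H q.1 q.2 := aux_H_meas ε t F hF
  have hFt : ∀ t', Measurable (F t') := fun t' => hF.of_uncurry_left
  set W := ∫⁻ t' in Set.Ioo t₀ t, ENNReal.ofReal (w t') with hW
  have hWle : W ≤ ENNReal.ofReal (B * (t - t₀) ^ (-(1 / p))) := by
    have := htime t₀ t ht
    rw [show 1 - 2 / p + 1 / p - 1 = -(1 / p) by ring] at this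
    exact this
  have hinner : ∀ t' ∈ Set.Ioo t₀ t, ENNReal.ofReal ((w t')⁻¹) *
      ∫⁻ ξ : Rd 3, ENNReal.ofReal (‖ξ‖ ^ (2 * s)) * H t' ξ ^ 2 ≤
      ENNReal.ofReal (ε⁻¹ ^ 2 * A) * K ^ 4 * ENNReal.ofReal (w t') := by
    intro t' h
    have h1 : 0 < t - t' := by linarith [h.2]
    have h2 : 0 < t' - t₀ := by linarith [h.1]
    have hwp := hwpos t' h
    have hpt : ∀ ξ : Rd 3, ENNReal.ofReal (‖ξ‖ ^ (2 * s)) * H t' ξ ^ 2 ≤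
        ENNReal.ofReal ((ε⁻¹ * (t - t') ^ (1 / p - 1)) ^ 2) *
          (ENNReal.ofReal (‖ξ‖ ^ (4 * s - 3)) * conv2E (F t') (F t') ξ ^ 2) := by
      intro ξ
      have h3 := aux_heat2 ε p (t - t') ‖ξ‖ hε hε1 hp h1 (norm_nonneg _)
      have h4 := ENNReal.ofReal_le_ofReal h3
      rw [ENNReal.ofReal_mul (by positivity), ENNReal.ofReal_pow (by positivity),
        ENNReal.ofReal_mul (q := ‖ξ‖ ^ _) (by positivity)] at h4
      simp only [hH]
      rw [mul_pow, ← mul_assoc, ← mul_assoc]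
      exact mul_le_mul_left h4 _
    calc _ ≤ ENNReal.ofReal ((w t')⁻¹) * ∫⁻ ξ : Rd 3,
          ENNReal.ofReal ((ε⁻¹ * (t - t') ^ (1 / p - 1)) ^ 2) *
          (ENNReal.ofReal (‖ξ‖ ^ (4 * s - 3)) * conv2E (F t') (F t') ξ ^ 2) :=
          mul_le_mul_right (lintegral_mono hpt) _
      _ = ENNReal.ofReal ((w t')⁻¹) * (ENNReal.ofReal ((ε⁻¹ * (t - t') ^ (1 / p - 1)) ^ 2) *
          ∫⁻ ξ : Rd 3,
          (ENNReal.ofReal (‖ξ‖ ^ (4 * s - 3)) * conv2E (F t') (F t') ξ ^ 2)) := by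
          rw [lintegral_const_mul' _ _ ENNReal.ofReal_ne_top]
      _ ≤ ENNReal.ofReal ((w t')⁻¹) * (ENNReal.ofReal ((ε⁻¹ * (t - t') ^ (1 / p - 1)) ^ 2) *
          (ENNReal.ofReal A * ((ENNReal.ofReal ((t' - t₀) ^ (-(1 / p))) * K) ^ 2) ^ 2)) := by
          refine mul_le_mul_right (mul_le_mul_right ((hbil (F t') (hFt t')).trans ?_) _) _
          exact mul_le_mul_right (pow_le_pow_left' (hN t' h) 2) _
      _ = ENNReal.ofReal ((w t')⁻¹ * (ε⁻¹ * (t - t') ^ (1 / p - 1)) ^ 2 * A *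
            ((t' - t₀) ^ (-(1 / p))) ^ 4) * K ^ 4 := by
          rw [ENNReal.ofReal_mul (by positivity), ENNReal.ofReal_mul (by positivity),
            ENNReal.ofReal_mul (by positivity), ENNReal.ofReal_pow (p := (t' - t₀) ^ (-(1 / p))) (by positivity)]
          ring
      _ = ENNReal.ofReal ((ε⁻¹ ^ 2 * A) * w t') * K ^ 4 := by
          congr 2
          have e : ((t' - t₀) ^ (-(1 / p))) ^ 4 = ((t' - t₀) ^ (1 - 2 / p - 1)) ^ 2 := by
            rw [← Real.rpow_natCast, ← Real.rpow_natCast, ← Real.rpow_mul h2.le, ← Real.rpow_mul h2.le]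
            congr 1; push_cast; ring
          rw [e]
          have : (w t')⁻¹ * w t' ^ 2 = w t' := by field_simp
          calc _ = ε⁻¹ ^ 2 * A * ((w t')⁻¹ * w t' ^ 2) := by simp only [hw]; ring
            _ = _ := by rw [this]
      _ = _ := by rw [ENNReal.ofReal_mul (by positivity)]; ring
  calc auxN s (fun ξ => ∫⁻ t' in Set.Ioo t₀ t, H t' ξ)
      ≤ ENNReal.ofReal (ε⁻¹ ^ 2 * A) * K ^ 4 * W ^ 2 :=
        aux_mink s t₀ t w H _ hwm hwpos hHm hinner
    _ ≤ ENNReal.ofReal (ε⁻¹ ^ 2 * A) * K ^ 4 * ENNReal.ofReal (B * (t - t₀) ^ (-(1 / p))) ^ 2 := by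
        gcongr
    _ = _ := by
        have hτ : 0 < t - t₀ := by linarith
        rw [mul_pow, ← ENNReal.ofReal_pow (by positivity), ← ENNReal.ofReal_pow (by positivity),
          mul_right_comm, ← ENNReal.ofReal_mul (by positivity), ← pow_mul]
        congr 2
        rw [mul_pow, mul_pow, mul_pow, mul_pow, Real.sq_sqrt hA.le]; ring

lemma aux_exp1 (ε lam T τ r : ℝ) (hε1 : ε < 1) (hT : 0 < T) (hτ : 0 ≤ τ) :
    -(lam ^ 2 * τ) / (4 * (1 - ε) * T) + lam * τ * r / √T ≤ (1 - ε) * τ * r ^ 2 := by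
  have hS : 0 < √T := Real.sqrt_pos.2 hT
  have hTS : T = √T ^ 2 := (Real.sq_sqrt hT.le).symm
  set S := √T with hSdef
  have hd : 0 < 1 - ε := by linarith
  have key : (1 - ε) * τ * r ^ 2 - (-(lam ^ 2 * τ) / (4 * (1 - ε) * T) + lam * τ * r / S) =
      τ * (1 - ε) * (r - lam / (2 * (1 - ε) * S)) ^ 2 := by
    rw [hTS]
    field_simp
    ring
  have : 0 ≤ τ * (1 - ε) * (r - lam / (2 * (1 - ε) * S)) ^ 2 := by positivity
  linarith

lemma aux_mink2 (s : ℝ) (f g : Rd 3 → ℝ≥0∞) (c : ℝ≥0∞) (hf : Measurable f) (hg : Measurable g) :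
    auxN s (fun ξ => f ξ + c * g ξ) ^ (1 / 2 : ℝ) ≤
      auxN s f ^ (1 / 2 : ℝ) + c * auxN s g ^ (1 / 2 : ℝ) := by
  have hN : ∀ h : Rd 3 → ℝ≥0∞, auxN s h = ∫⁻ ξ, (ENNReal.ofReal (‖ξ‖ ^ s) * h ξ) ^ (2 : ℝ) := by
    intro h
    rw [auxN]
    congr with x
    rw [ENNReal.rpow_two, mul_pow, ← ENNReal.ofReal_pow (by positivity), ← Real.rpow_natCast,
      ← Real.rpow_mul (norm_nonneg _)]
    norm_num [mul_comm]
  have h1 := ENNReal.lintegral_Lp_add_le (μ := (volume : Measure (Rd 3))) (p := 2)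
    (f := fun ξ => ENNReal.ofReal (‖ξ‖ ^ s) * f ξ) (g := fun ξ => ENNReal.ofReal (‖ξ‖ ^ s) * (c * g ξ))
    (by fun_prop) (by fun_prop) (by norm_num)
  have h2 : auxN s (fun ξ => c * g ξ) ^ (1 / 2 : ℝ) = c * auxN s g ^ (1 / 2 : ℝ) := by
    have : auxN s (fun ξ => c * g ξ) = c ^ 2 * auxN s g := by
      rw [auxN, auxN, ← lintegral_const_mul _ (by fun_prop)]
      congr with x
      ring
    rw [this, ENNReal.mul_rpow_of_nonneg _ _ (by norm_num), ← ENNReal.rpow_two, ← ENNReal.rpow_mul]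
    norm_num
  rw [← h2, hN, hN, hN]
  simpa only [Pi.add_apply, ← mul_add] using h1

lemma aux_hSobR (s : ℝ) (g : Rd 3 → ℝ) (hg : ∀ ξ, 0 ≤ g ξ) :
    hSobR 3 s g = auxN s (fun ξ => ENNReal.ofReal (g ξ)) ^ (1 / 2 : ℝ) := by
  rw [hSobR, auxN]
  congr with ξ
  rw [ENNReal.ofReal_mul (by positivity), ENNReal.ofReal_pow (hg ξ)]

lemma aux_hSob (s : ℝ) (g : Rd 3 → CN 3) :
    hSob 3 3 s g = auxN s (fun ξ => ENNReal.ofReal ‖g ξ‖) ^ (1 / 2 : ℝ) := by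
  rw [hSob, auxN]
  congr with ξ
  rw [ENNReal.ofReal_mul (by positivity), ENNReal.ofReal_pow (norm_nonneg _)]

lemma aux_gev_conv (ε lam T t₀ t' : ℝ) (hε1 : ε < 1) (hlam : 0 < lam) (hT : 0 < T)
    (h1 : t₀ < t') (h2 : t' ≤ t₀ + T) (u : ℝ → Rd 3 → CN 3) (ξ : Rd 3) :
    ENNReal.ofReal (Real.exp (-(lam ^ 2 * (t' - t₀)) / (4 * (1 - ε) * T) +
        lam * (t' - t₀) * ‖ξ‖ / √T)) *
      conv2E (fun η => ENNReal.ofReal ‖u t' η‖) (fun η => ENNReal.ofReal ‖u t' η‖) ξ ≤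
    ENNReal.ofReal (Real.exp (lam ^ 2 / (4 * (1 - ε)))) *
      conv2E (fun η => ENNReal.ofReal (NSgevrey ε lam T t₀ u t' η))
        (fun η => ENNReal.ofReal (NSgevrey ε lam T t₀ u t' η)) ξ := by
  have hd : 0 < 1 - ε := by linarith
  rw [conv2E, conv2E, ← lintegral_const_mul' _ _ ENNReal.ofReal_ne_top,
    ← lintegral_const_mul' _ _ ENNReal.ofReal_ne_top]
  apply lintegral_mono
  intro η
  simp only [NSgevrey]
  rw [← ENNReal.ofReal_mul (by positivity), ← ENNReal.ofReal_mul (by positivity),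
    ← ENNReal.ofReal_mul (by positivity), ← ENNReal.ofReal_mul (by positivity)]
  apply ENNReal.ofReal_le_ofReal
  set a := lam ^ 2 / (4 * (1 - ε)) with ha
  set k := lam * (t' - t₀) / √T with hk
  have ha0 : 0 ≤ a := by positivity
  have hk0 : 0 ≤ k := by
    have : 0 < t' - t₀ := by linarith
    positivity
  have e0 : -(lam ^ 2 * (t' - t₀)) / (4 * (1 - ε) * T) = - (a * ((t' - t₀) / T)) := by
    rw [ha]; field_simp
  have e1 : ∀ r : ℝ, lam * (t' - t₀) * r / √T = k * r := by intro r; rw [hk]; ring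
  rw [e0, e1, e1, e1]
  have hq : (t' - t₀) / T ≤ 1 := by rw [div_le_one hT]; linarith
  have htri : ‖ξ‖ ≤ ‖η‖ + ‖ξ - η‖ := by
    have := norm_add_le η (ξ - η)
    simpa using this
  have hexp : Real.exp (-(a * ((t' - t₀) / T)) + k * ‖ξ‖) ≤
      Real.exp a * (Real.exp (-(a * ((t' - t₀) / T)) + k * ‖η‖) *
        Real.exp (-(a * ((t' - t₀) / T)) + k * ‖ξ - η‖)) := by
    rw [← Real.exp_add, ← Real.exp_add]
    apply Real.exp_le_exp.2
    nlinarith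
  calc _ ≤ Real.exp a * (Real.exp (-(a * ((t' - t₀) / T)) + k * ‖η‖) *
        Real.exp (-(a * ((t' - t₀) / T)) + k * ‖ξ - η‖)) * (‖u t' η‖ * ‖u t' (ξ - η)‖) :=
        mul_le_mul_of_nonneg_right hexp (by positivity)
    _ = _ := by ring

lemma aux_pt (ε lam T t₀ t C₀ : ℝ) (hε1 : ε < 1) (hC₀ : 0 < C₀)
    (hlam : 0 < lam) (hT : 0 < T) (h1 : t₀ < t) (h2 : t ≤ t₀ + T) (u : ℝ → Rd 3 → CN 3)
    (hD : NSDuhamelIneq C₀ t₀ T u) (ξ : Rd 3) :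
    ENNReal.ofReal (NSgevrey ε lam T t₀ u t ξ) ≤
      ENNReal.ofReal ‖heatHat 3 3 (ε * (t - t₀)) (u t₀) ξ‖ +
      ENNReal.ofReal (C₀ * Real.exp (lam ^ 2 / (4 * (1 - ε)))) *
        ∫⁻ t' in Set.Ioo t₀ t,
          ENNReal.ofReal (Real.exp (-(ε * (t - t') * ‖ξ‖ ^ 2)) * ‖ξ‖) *
            conv2E (fun η => ENNReal.ofReal (NSgevrey ε lam T t₀ u t' η))
              (fun η => ENNReal.ofReal (NSgevrey ε lam T t₀ u t' η)) ξ := by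
  have hd := hD t ⟨h1, h2⟩ ξ
  set E : ℝ → ℝ := fun t => Real.exp (-(lam ^ 2 * (t - t₀)) / (4 * (1 - ε) * T) +
        lam * (t - t₀) * ‖ξ‖ / √T) with hE
  set L := Real.exp (lam ^ 2 / (4 * (1 - ε))) with hL
  have e1 : ENNReal.ofReal (NSgevrey ε lam T t₀ u t ξ) =
      ENNReal.ofReal (E t) * ENNReal.ofReal ‖u t ξ‖ := by
    rw [← ENNReal.ofReal_mul (Real.exp_pos _).le]; rfl
  rw [e1]
  refine (mul_le_mul_right hd _).trans ?_
  rw [mul_add]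
  refine add_le_add ?_ ?_
  · rw [← ENNReal.ofReal_mul (Real.exp_pos _).le]
    apply ENNReal.ofReal_le_ofReal
    rw [heatHat, norm_smul, Real.norm_eq_abs, abs_of_pos (Real.exp_pos _), ← mul_assoc]
    refine mul_le_mul_of_nonneg_right ?_ (norm_nonneg _)
    rw [← Real.exp_add]
    apply Real.exp_le_exp.2
    have := aux_exp1 ε lam T (t - t₀) ‖ξ‖ hε1 hT (by linarith)
    linarith
  · rw [ENNReal.ofReal_mul hC₀.le, mul_left_comm, mul_assoc]
    refine mul_le_mul_right ?_ _
    rw [← restrict_Ioo_eq_restrict_Ioc, ← lintegral_const_mul' _ _ ENNReal.ofReal_ne_top,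
      ← lintegral_const_mul' _ _ ENNReal.ofReal_ne_top]
    refine setLIntegral_mono_ae' measurableSet_Ioo (Eventually.of_forall ?_)
    intro t' ht'
    have hg := aux_gev_conv ε lam T t₀ t' hε1 hlam hT ht'.1 (by linarith [ht'.2]) u ξ
    have hreal : E t * (Real.exp (-((t - t') * ‖ξ‖ ^ 2)) * ‖ξ‖) ≤
        (Real.exp (-(ε * (t - t') * ‖ξ‖ ^ 2)) * ‖ξ‖) * E t' := by
      have : E t * Real.exp (-((t - t') * ‖ξ‖ ^ 2)) ≤ Real.exp (-(ε * (t - t') * ‖ξ‖ ^ 2)) * E t' := by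
        simp only [hE]
        rw [← Real.exp_add, ← Real.exp_add]
        apply Real.exp_le_exp.2
        have := aux_exp1 ε lam T (t - t') ‖ξ‖ hε1 hT (by linarith [ht'.2])
        have e : -(lam ^ 2 * (t - t₀)) / (4 * (1 - ε) * T) + lam * (t - t₀) * ‖ξ‖ / √T =
          (-(lam ^ 2 * (t - t')) / (4 * (1 - ε) * T) + lam * (t - t') * ‖ξ‖ / √T) +
          (-(lam ^ 2 * (t' - t₀)) / (4 * (1 - ε) * T) + lam * (t' - t₀) * ‖ξ‖ / √T) := by ring
        rw [e]
        linarith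
      calc _ = (E t * Real.exp (-((t - t') * ‖ξ‖ ^ 2))) * ‖ξ‖ := by ring
        _ ≤ _ := mul_le_mul_of_nonneg_right this (norm_nonneg _)
        _ = _ := by ring
    have hreal2 := ENNReal.ofReal_le_ofReal hreal
    rw [ENNReal.ofReal_mul (Real.exp_pos _).le, ENNReal.ofReal_mul (q := E t') (by positivity)] at hreal2
    rw [← mul_assoc]
    refine (mul_le_mul_left hreal2 _).trans ?_
    rw [mul_assoc, mul_left_comm (ENNReal.ofReal L)]
    exact mul_le_mul_right hg _

lemma aux_meas_u (u : ℝ → Rd 3 → CN 3)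
    (hu : ∀ j : Fin 3, Measurable fun q : ℝ × Rd 3 => u q.1 q.2 j) :
    Measurable fun q : ℝ × Rd 3 => ‖u q.1 q.2‖ := by
  simp only [EuclideanSpace.norm_eq]
  refine Measurable.sqrt ?_
  refine Finset.measurable_sum _ fun j _ => ?_
  exact ((hu j).norm).pow_const 2

lemma aux_slice (f : ℝ → Rd 3 → ℝ) (t₀ : ℝ)
    (hf : Measurable fun q : ℝ × Rd 3 => f q.1 q.2) : Measurable (f t₀) :=
  Measurable.of_uncurry_left (f := f) hf

lemma aux_h0 (t₀ : ℝ) (u : ℝ → Rd 3 → CN 3)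
    (hum : Measurable fun q : ℝ × Rd 3 => ‖u q.1 q.2‖) : Measurable fun ξ : Rd 3 => ‖u t₀ ξ‖ :=
  aux_slice (fun t ξ => ‖u t ξ‖) t₀ hum

lemma aux_h1 (a : ℝ) (u : Rd 3 → CN 3) (ξ : Rd 3) :
    ‖heatHat 3 3 a u ξ‖ = Real.exp (-(a * ‖ξ‖ ^ 2)) * ‖u ξ‖ := by
  unfold heatHat
  exact (norm_smul (Real.exp (-(a * ‖ξ‖ ^ 2))) (u ξ)).trans
    (congrArg (· * ‖u ξ‖) (abs_of_pos (Real.exp_pos _)))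

lemma aux_h3 (a : ℝ) : Measurable fun ξ : Rd 3 => Real.exp (-(a * ‖ξ‖ ^ 2)) := by fun_prop

lemma aux_P_meas (a t₀ : ℝ) (u : ℝ → Rd 3 → CN 3)
    (hum : Measurable fun q : ℝ × Rd 3 => ‖u q.1 q.2‖) :
    Measurable fun ξ : Rd 3 => ENNReal.ofReal ‖heatHat 3 3 a (u t₀) ξ‖ := by
  have h := ((aux_h3 a).mul (aux_h0 t₀ u hum)).ennreal_ofReal
  have e : (fun ξ : Rd 3 => ENNReal.ofReal ‖heatHat 3 3 a (u t₀) ξ‖) =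
    fun ξ : Rd 3 => ENNReal.ofReal (Real.exp (-(a * ‖ξ‖ ^ 2)) * ‖u t₀ ξ‖) := by
    funext ξ; rw [aux_h1]
  rw [e]; exact h

/-- inequality (3.3): the Navier–Stokes key Gevrey estimate with initial
time `t₀`.  Let `ε ∈ (0,1)`, `p ∈ (2,∞)`, `C₀ > 0`.  There is `C_ε > 0` (depending only
on `p`, `ε`, `C₀`) such that for all `λ > 0`, `T > 0`, `t₀ ≥ 0` and `u` satisfying the
Fourier-side Duhamel inequality on `(t₀, t₀+T]`,
`‖u_{a,t₀}‖_{K^p_{t₀,T}} ≤ ‖e^{ε(t−t₀)Δ}u(t₀)‖_{K^p_{t₀,T}}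
  + C_ε e^{λ²/(4(1−ε))} ‖u_{a,t₀}‖_{K^p_{t₀,T}}²`. -/
theorem statement15 (ε p C₀ : ℝ) (hε : ε ∈ Set.Ioo (0:ℝ) 1) (hp : 2 < p)
    (hC₀ : 0 < C₀) :
    ∃ C > (0:ℝ), ∀ lam T t₀ : ℝ, 0 < lam → 0 < T → 0 ≤ t₀ →
      ∀ u : ℝ → Rd 3 → CN 3,
        (∀ j : Fin 3, Measurable fun q : ℝ × Rd 3 => u q.1 q.2 j) →
        NSDuhamelIneq C₀ t₀ T u →
        NSkatoR p t₀ T (NSgevrey ε lam T t₀ u) ≤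
          NSkatoC p t₀ T (fun t => heatHat 3 3 (ε * (t - t₀)) (u t₀)) +
            ENNReal.ofReal (C * Real.exp (lam ^ 2 / (4 * (1 - ε)))) *
              NSkatoR p t₀ T (NSgevrey ε lam T t₀ u) ^ 2 := by
  obtain ⟨D, hDpos, hduh⟩ := aux_duh ε p hε.1 hε.2 hp
  refine ⟨C₀ * D, by positivity, fun lam T t₀ hlam hT _ u hu hDu => ?_⟩
  set V := NSgevrey ε lam T t₀ u with hV
  set K := NSkatoR p t₀ T V with hK
  have hVnn : ∀ t ξ, 0 ≤ V t ξ := fun t ξ => mul_nonneg (Real.exp_pos _).le (norm_nonneg _)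
  have hum := aux_meas_u u hu
  have hFm : Measurable (Function.uncurry fun (t : ℝ) (ξ : Rd 3) => ENNReal.ofReal (V t ξ)) := by
    have : Measurable fun q : ℝ × Rd 3 =>
        Real.exp (-(lam ^ 2 * (q.1 - t₀)) / (4 * (1 - ε) * T) + lam * (q.1 - t₀) * ‖q.2‖ / √T)
          * ‖u q.1 q.2‖ := by fun_prop
    exact this.ennreal_ofReal
  have hNb : ∀ t ∈ Set.Ioc t₀ (t₀ + T), auxN (1 / 2 + 2 / p) (fun ξ => ENNReal.ofReal (V t ξ)) ≤
      (ENNReal.ofReal ((t - t₀) ^ (-(1 / p))) * K) ^ 2 := by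
    intro t ht
    have hτ : 0 < t - t₀ := by linarith [ht.1]
    have h1 : ENNReal.ofReal ((t - t₀) ^ (1 / p)) * hSobR 3 (1 / 2 + 2 / p) (V t) ≤ K := by
      rw [hK, NSkatoR]
      exact le_iSup₂ (f := fun t (_ : t ∈ Set.Ioc t₀ (t₀ + T)) =>
        ENNReal.ofReal ((t - t₀) ^ (1 / p)) * hSobR 3 (1 / 2 + 2 / p) (V t)) t ht
    rw [aux_hSobR _ _ (hVnn t)] at h1
    set N := auxN (1 / 2 + 2 / p) (fun ξ => ENNReal.ofReal (V t ξ)) with hN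
    have e : ENNReal.ofReal ((t - t₀) ^ (-(1 / p))) * ENNReal.ofReal ((t - t₀) ^ (1 / p)) = 1 := by
      rw [← ENNReal.ofReal_mul (by positivity), ← Real.rpow_add hτ]; simp
    calc N = (N ^ (1 / 2 : ℝ)) ^ 2 := by
          rw [← ENNReal.rpow_two, ← ENNReal.rpow_mul]; norm_num
      _ = (ENNReal.ofReal ((t - t₀) ^ (-(1 / p))) *
            (ENNReal.ofReal ((t - t₀) ^ (1 / p)) * N ^ (1 / 2 : ℝ))) ^ 2 := by
          rw [← mul_assoc, e, one_mul]
      _ ≤ _ := pow_le_pow_left' (mul_le_mul_right h1 _) 2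
  suffices hmain : ∀ t ∈ Set.Ioc t₀ (t₀ + T),
      ENNReal.ofReal ((t - t₀) ^ (1 / p)) * hSobR 3 (1 / 2 + 2 / p) (V t) ≤
        NSkatoC p t₀ T (fun t => heatHat 3 3 (ε * (t - t₀)) (u t₀)) +
          ENNReal.ofReal (C₀ * D * Real.exp (lam ^ 2 / (4 * (1 - ε)))) * K ^ 2 from
    (le_of_eq hK).trans (iSup₂_le hmain)
  intro t ht
  have hτ : 0 < t - t₀ := by linarith [ht.1]
  set G : Rd 3 → ℝ≥0∞ := fun ξ => ∫⁻ t' in Set.Ioo t₀ t,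
          ENNReal.ofReal (Real.exp (-(ε * (t - t') * ‖ξ‖ ^ 2)) * ‖ξ‖) *
            conv2E (fun η => ENNReal.ofReal (V t' η)) (fun η => ENNReal.ofReal (V t' η)) ξ with hG
  have hGm : Measurable G :=
    aux_G_meas ε t₀ t (fun (t : ℝ) (ξ : Rd 3) => ENNReal.ofReal (V t ξ)) hFm
  have hGN : auxN (1 / 2 + 2 / p) G ≤ (ENNReal.ofReal (D * (t - t₀) ^ (-(1 / p))) * K ^ 2) ^ 2 :=
    hduh t₀ t (fun (t : ℝ) (ξ : Rd 3) => ENNReal.ofReal (V t ξ)) K ht.1 hFm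
      (fun t' ht' => hNb t' ⟨ht'.1, by linarith [ht'.2, ht.2]⟩)
  have hGN2 : auxN (1 / 2 + 2 / p) G ^ (1 / 2 : ℝ) ≤
      ENNReal.ofReal (D * (t - t₀) ^ (-(1 / p))) * K ^ 2 := by
    refine (ENNReal.rpow_le_rpow hGN (by norm_num)).trans (le_of_eq ?_)
    rw [← ENNReal.rpow_two (x := ENNReal.ofReal (D * (t - t₀) ^ (-(1 / p))) * K ^ 2),
      ← ENNReal.rpow_mul]
    norm_num
  set P : Rd 3 → ℝ≥0∞ := fun ξ => ENNReal.ofReal ‖heatHat 3 3 (ε * (t - t₀)) (u t₀) ξ‖ with hP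
  have hPm : Measurable P := aux_P_meas (ε * (t - t₀)) t₀ u hum
  set c := C₀ * Real.exp (lam ^ 2 / (4 * (1 - ε))) with hc
  have hcpos : 0 < c := by positivity
  have hmono : auxN (1 / 2 + 2 / p) (fun ξ => ENNReal.ofReal (V t ξ)) ≤
      auxN (1 / 2 + 2 / p) (fun ξ => P ξ + ENNReal.ofReal c * G ξ) := by
    refine lintegral_mono fun ξ => mul_le_mul_right (pow_le_pow_left' ?_ 2) _
    exact aux_pt ε lam T t₀ t C₀ hε.2 hC₀ hlam hT ht.1 ht.2 u hDu ξ
  have hfirst : ENNReal.ofReal ((t - t₀) ^ (1 / p)) * auxN (1 / 2 + 2 / p) P ^ (1 / 2 : ℝ) ≤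
      NSkatoC p t₀ T (fun t => heatHat 3 3 (ε * (t - t₀)) (u t₀)) := by
    rw [hP, ← aux_hSob, NSkatoC]
    exact le_iSup₂ (f := fun t (_ : t ∈ Set.Ioc t₀ (t₀ + T)) =>
        ENNReal.ofReal ((t - t₀) ^ (1 / p)) *
          hSob 3 3 (1 / 2 + 2 / p) (heatHat 3 3 (ε * (t - t₀)) (u t₀))) t ht
  have e2 : (t - t₀) ^ (1 / p) * (c * (D * (t - t₀) ^ (-(1 / p)))) =
      C₀ * D * Real.exp (lam ^ 2 / (4 * (1 - ε))) := by
    have : (t - t₀) ^ (1 / p) * (t - t₀) ^ (-(1 / p)) = 1 := by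
      rw [← Real.rpow_add hτ]; simp
    calc _ = ((t - t₀) ^ (1 / p) * (t - t₀) ^ (-(1 / p))) * (c * D) := by ring
      _ = _ := by rw [this, hc]; ring
  rw [aux_hSobR _ _ (hVnn t)]
  calc _ ≤ ENNReal.ofReal ((t - t₀) ^ (1 / p)) *
        (auxN (1 / 2 + 2 / p) P ^ (1 / 2 : ℝ) +
          ENNReal.ofReal c * auxN (1 / 2 + 2 / p) G ^ (1 / 2 : ℝ)) :=
        mul_le_mul_right ((ENNReal.rpow_le_rpow hmono (by norm_num)).trans
          (aux_mink2 _ P G _ hPm hGm)) _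
    _ ≤ ENNReal.ofReal ((t - t₀) ^ (1 / p)) *
        (auxN (1 / 2 + 2 / p) P ^ (1 / 2 : ℝ) +
          ENNReal.ofReal c * (ENNReal.ofReal (D * (t - t₀) ^ (-(1 / p))) * K ^ 2)) := by
        gcongr
    _ = ENNReal.ofReal ((t - t₀) ^ (1 / p)) * auxN (1 / 2 + 2 / p) P ^ (1 / 2 : ℝ) +
        ENNReal.ofReal (C₀ * D * Real.exp (lam ^ 2 / (4 * (1 - ε)))) * K ^ 2 := by
        rw [← e2, ENNReal.ofReal_mul (p := (t - t₀) ^ (1 / p)) (Real.rpow_nonneg hτ.le _),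
          ENNReal.ofReal_mul (p := c) (q := D * (t - t₀) ^ (-(1 / p))) hcpos.le]
        ring
    _ ≤ _ := by gcongr

end
end
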